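/- arXiv:1001.1831 — 9 statements merged into one kernel-verified Lean document; each statement's English description precedes it below -/
import Mathlib

section
/- Let K : ℝ → ℝ be Lipschitz continuous and bounded, let (h_N) be a sequence of positive reals with N/h_N → ζ as N → ∞ for some ζ ∈ [1,∞), and let κ ∈ (0,1). Let φ_N, φ : [0,1] → ℝ be bounded measurable functions with φ continuous and sup_{r∈[0,1]} |φ_N(r) − φ(r)| → 0. Then sup_{s∈[κ,1]} | (N/h_N) ∫_0^s φ_N(r) K((⌊Nr⌋ − ⌊Ns⌋)/h_N) dr − ζ ∫_0^s φ(r) K(ζ(r − s)) dr | → 0 as N → ∞. -/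
/-- The increment of `⌊n * ·⌋` differs from the increment of `n * ·` by at most one. -/
theorem abs_floor_mul_sub_floor_mul_sub_le (n r s : ℝ) :
    |((⌊n * r⌋ : ℝ) - ⌊n * s⌋) - n * (r - s)| ≤ 1 := by
  have h1 := Int.floor_le (n * r)
  have h2 := Int.lt_floor_add_one (n * r)
  have h3 := Int.floor_le (n * s)
  have h4 := Int.lt_floor_add_one (n * s)
  rw [abs_le]
  constructor <;> linarith

/-- If `n / h` is close to `ζ` and `h` is large, the discretised increment `(⌊n r⌋ - ⌊n s⌋) / h`
is close to `ζ (r - s)`. -/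
theorem abs_floor_increment_div_sub_le {n h ζ r s : ℝ} (hh : 0 < h) (hrs : |r - s| ≤ 1) :
    |((⌊n * r⌋ : ℝ) - ⌊n * s⌋) / h - ζ * (r - s)| ≤ 1 / h + |n / h - ζ| := by
  have heq : ((⌊n * r⌋ : ℝ) - ⌊n * s⌋) / h - ζ * (r - s) =
      (((⌊n * r⌋ : ℝ) - ⌊n * s⌋) - n * (r - s)) / h + (n / h - ζ) * (r - s) := by
    field_simp
    ring
  rw [heq]
  refine (abs_add_le _ _).trans (add_le_add ?_ ?_)
  · rw [abs_div, abs_of_pos hh]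
    gcongr
    exact abs_floor_mul_sub_floor_mul_sub_le n r s
  · rw [abs_mul]
    exact mul_le_of_le_one_right (abs_nonneg _) hrs

/-- Stability of a triple product under perturbation of each factor. -/
theorem abs_mul_mul_sub_mul_mul_le {a ζ f g k l δ M C D : ℝ} (hζ : 0 ≤ ζ) (hδ : δ ≤ 1)
    (ha : |a - ζ| ≤ δ) (hfg : |f - g| ≤ δ) (hg : |g| ≤ M) (hk : |k| ≤ C) (hkl : |k - l| ≤ δ * D) :
    |a * (f * k) - ζ * (g * l)| ≤ δ * ((M + 1) * C + ζ * C + ζ * (M * D)) := by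
  have hδ0 : 0 ≤ δ := (abs_nonneg _).trans ha
  have hM : 0 ≤ M := (abs_nonneg _).trans hg
  have hC : 0 ≤ C := (abs_nonneg _).trans hk
  have hf : |f| ≤ M + 1 := by
    have := abs_add_le (f - g) g
    rw [sub_add_cancel] at this
    linarith
  have heq : a * (f * k) - ζ * (g * l) =
      (a - ζ) * (f * k) + ζ * ((f - g) * k) + ζ * (g * (k - l)) := by ring
  rw [heq]
  calc _ ≤ |a - ζ| * (|f| * |k|) + ζ * (|f - g| * |k|) + ζ * (|g| * |k - l|) := by
        refine (abs_add_three _ _ _).trans_eq ?_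
        simp only [abs_mul, abs_of_nonneg hζ]
    _ ≤ δ * ((M + 1) * C) + ζ * (δ * C) + ζ * (M * (δ * D)) := by gcongr
    _ = _ := by ring

/-- A bounded measurable function is interval integrable. -/
theorem intervalIntegrable_of_measurable_of_abs_le {f : ℝ → ℝ} {a b C : ℝ} (hf : Measurable f)
    (hab : a ≤ b) (hC : ∀ r ∈ Set.Ioc a b, |f r| ≤ C) :
    IntervalIntegrable f MeasureTheory.volume a b := by
  rw [intervalIntegrable_iff_integrableOn_Ioc_of_le hab]
  refine MeasureTheory.IntegrableOn.of_bound measure_Ioc_lt_top hf.aestronglyMeasurable C ?_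
  exact (MeasureTheory.ae_restrict_iff' measurableSet_Ioc).2 (Filter.Eventually.of_forall hC)


/-- Kernel-weighted Riemann approximation. `K` Lipschitz and bounded,
`N/h_N → ζ ∈ [1,∞)`, `κ ∈ (0,1)`, `φ_N, φ : [0,1] → ℝ` bounded measurable with `φ`
continuous and `sup_{r∈[0,1]} |φ_N(r) − φ(r)| → 0`. Then
`sup_{s∈[κ,1]} |(N/h_N) ∫_0^s φ_N(r) K((⌊Nr⌋ − ⌊Ns⌋)/h_N) dr −
  ζ ∫_0^s φ(r) K(ζ(r − s)) dr| → 0` as `N → ∞`. -/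
theorem kernel_weighted_riemann_approximation (K : ℝ → ℝ) (L : NNReal)
    (hK : LipschitzWith L K) (CK : ℝ) (hKbd : ∀ x, |K x| ≤ CK)
    (h : ℕ → ℝ) (hpos : ∀ N, 0 < h N) (ζ : ℝ) (hζ : 1 ≤ ζ)
    (hconv : Filter.Tendsto (fun N : ℕ => (N : ℝ) / h N) Filter.atTop (nhds ζ))
    (κ : ℝ) (hκ : κ ∈ Set.Ioo (0 : ℝ) 1)
    (φN : ℕ → ℝ → ℝ) (φ : ℝ → ℝ)
    (hmeas : ∀ N, Measurable (φN N))
    (hbd : ∀ N, ∃ C : ℝ, ∀ r ∈ Set.Icc (0 : ℝ) 1, |φN N r| ≤ C)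
    (hφcont : ContinuousOn φ (Set.Icc (0 : ℝ) 1))
    (hφconv : ∀ ε > (0 : ℝ), ∃ N₀ : ℕ, ∀ N : ℕ, N₀ ≤ N →
      ∀ r ∈ Set.Icc (0 : ℝ) 1, |φN N r - φ r| < ε) :
    ∀ ε > (0 : ℝ), ∃ N₀ : ℕ, ∀ N : ℕ, N₀ ≤ N → ∀ s ∈ Set.Icc κ 1,
      |((N : ℝ) / h N) *
          (∫ r in (0 : ℝ)..s, φN N r * K ((↑⌊(N : ℝ) * r⌋ - ↑⌊(N : ℝ) * s⌋) / h N)) -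
        ζ * ∫ r in (0 : ℝ)..s, φ r * K (ζ * (r - s))| < ε := by
  intro ε hε
  have hζ0 : 0 ≤ ζ := zero_le_one.trans hζ
  have hCK : 0 ≤ CK := (abs_nonneg _).trans (hKbd 0)
  obtain ⟨M, hM⟩ := isCompact_Icc.exists_bound_of_continuousOn hφcont
  simp only [Real.norm_eq_abs] at hM
  have hM0 : 0 ≤ M := (abs_nonneg _).trans (hM 0 (by simp))
  set B : ℝ := (M + 1) * CK + ζ * CK + ζ * (M * (2 * L)) with hB
  have hB0 : 0 ≤ B := by positivity
  set δ : ℝ := ε / (B + 1 + ε) with hδ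
  have hδ0 : 0 < δ := by positivity
  have hδ1 : δ ≤ 1 := by
    rw [hδ, div_le_one (by positivity)]
    linarith
  have hδB : δ * B < ε := by
    rw [hδ, div_mul_eq_mul_div, div_lt_iff₀ (by positivity)]
    nlinarith [mul_pos hε hε]
  have hinv : Filter.Tendsto (fun N : ℕ => 1 / h N) Filter.atTop (nhds 0) := by
    have h0 := hconv.mul (tendsto_one_div_atTop_nhds_zero_nat (𝕜 := ℝ))
    rw [mul_zero] at h0
    refine h0.congr' ?_
    filter_upwards [Filter.eventually_gt_atTop 0] with N hN
    have : (N : ℝ) ≠ 0 := by exact_mod_cast hN.ne'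
    have := (hpos N).ne'
    field_simp
  obtain ⟨N₁, hN₁⟩ := hφconv δ hδ0
  obtain ⟨N₂, hN₂⟩ := Metric.tendsto_atTop.1 hconv δ hδ0
  obtain ⟨N₃, hN₃⟩ := Filter.eventually_atTop.1 (hinv.eventually_lt_const hδ0)
  refine ⟨max N₁ (max N₂ N₃), fun N hN s hs => ?_⟩
  simp only [max_le_iff] at hN
  have hφN := hN₁ N hN.1
  have ha := (hN₂ N hN.2.1).le
  rw [Real.dist_eq] at ha
  have hh := (hN₃ N hN.2.2).le
  have hs0 : 0 ≤ s := hκ.1.le.trans hs.1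
  have hsub : Set.Icc 0 s ⊆ Set.Icc (0 : ℝ) 1 := Set.Icc_subset_Icc_right hs.2
  have hint₁ : IntervalIntegrable
      (fun r => φN N r * K ((↑⌊(N : ℝ) * r⌋ - ↑⌊(N : ℝ) * s⌋) / h N))
      MeasureTheory.volume 0 s := by
    obtain ⟨C, hC⟩ := hbd N
    have hKmeas := hK.continuous.measurable
    refine intervalIntegrable_of_measurable_of_abs_le (C := C * CK)
      ((hmeas N).mul (hKmeas.comp (by fun_prop))) hs0 fun r hr => ?_
    have hCr := hC r (hsub (Set.Ioc_subset_Icc_self hr))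
    rw [abs_mul]
    exact mul_le_mul hCr (hKbd _) (abs_nonneg _) ((abs_nonneg _).trans hCr)
  have hint₂ : IntervalIntegrable (fun r => φ r * K (ζ * (r - s)))
      MeasureTheory.volume 0 s := by
    refine ContinuousOn.intervalIntegrable_of_Icc hs0 ((hφcont.mono hsub).mul ?_)
    exact (hK.continuous.comp (by fun_prop)).continuousOn
  rw [← intervalIntegral.integral_const_mul, ← intervalIntegral.integral_const_mul,
    ← intervalIntegral.integral_sub (hint₁.const_mul _) (hint₂.const_mul _), ← Real.norm_eq_abs]
  refine (intervalIntegral.norm_integral_le_of_norm_le_const (C := δ * B) ?_).trans_lt ?_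
  · intro r hr
    rw [Set.uIoc_of_le hs0] at hr
    have hr1 := hsub (Set.Ioc_subset_Icc_self hr)
    rw [Real.norm_eq_abs]
    refine abs_mul_mul_sub_mul_mul_le hζ0 hδ1 ha (hφN r hr1).le (hM r hr1) (hKbd _) ?_
    have hrs : |r - s| ≤ 1 := by
      rw [abs_le]
      constructor <;> linarith [hr.1, hr.2, hs.2]
    calc _ ≤ (L : ℝ) * |((⌊(N : ℝ) * r⌋ : ℝ) - ⌊(N : ℝ) * s⌋) / h N - ζ * (r - s)| := by
          simpa only [Real.dist_eq] using hK.dist_le_mul _ _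
      _ ≤ L * (δ + δ) := by
          gcongr
          exact (abs_floor_increment_div_sub_le (hpos N) hrs).trans (add_le_add hh ha)
      _ = δ * (2 * L) := by ring
  · rw [sub_zero, abs_of_nonneg hs0]
    exact (mul_le_of_le_one_right (by positivity) hs.2).trans_lt hδB
end

section
/- Let K : ℝ → ℝ be Lipschitz continuous and bounded, let (h_N) be a sequence of positive reals with N/h_N → ζ as N → ∞ for some ζ ∈ [1,∞), and let κ ∈ (0,1). Let A : [0,1] → ℝ be continuous, and let (y_{N,i}), 1 ≤ i ≤ N, be a triangular array of reals such that sup_{s∈[0,1]} | N^{−3/2} ∑_{j=1}^{⌊Ns⌋} y_{N,j} − A(s) | → 0 as N → ∞. Then sup_{s∈[κ,1]} | ⌊Ns⌋^{−3} ∑_{i=1}^{⌊Ns⌋} ( ∑_{j=1}^{i} y_{N,j} )^2 K_{h_N}(i − ⌊Ns⌋) − s^{−3} ζ ∫_0^s A(r)^2 K(ζ(r − s)) dr | → 0 as N → ∞. -/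
open Filter Topology Asymptotics MeasureTheory

/-- The difference of two products vanishes in the limit when the differences of the factors do
and the limiting factors are bounded. -/
theorem isLittleO_one_mul_sub_mul {α : Type*} {l : Filter α} {f₁ f₂ g₁ g₂ : α → ℝ}
    (h₁ : (fun x => f₁ x - g₁ x) =o[l] (fun _ => (1 : ℝ)))
    (h₂ : (fun x => f₂ x - g₂ x) =o[l] (fun _ => (1 : ℝ)))
    (b₁ : g₁ =O[l] (fun _ => (1 : ℝ))) (b₂ : g₂ =O[l] (fun _ => (1 : ℝ))) :
    (fun x => f₁ x * f₂ x - g₁ x * g₂ x) =o[l] (fun _ => (1 : ℝ)) := by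
  have H := ((h₁.mul h₂).add (h₁.mul_isBigO b₂)).add (b₁.mul_isLittleO h₂)
  simp only [mul_one] at H
  refine H.congr_left fun x => ?_
  ring

/-- A Riemann sum over a grid of mesh `1 / N` whose weights are uniformly close to the integrand
is close to the integral. -/
theorem abs_riemann_sum_sub_integral_le {N : ℕ} (hN : 0 < N) (M : ℕ) (c : ℕ → ℝ) (φ : ℝ → ℝ)
    (δ : ℝ)
    (hφ : ∀ i < M, IntervalIntegrable φ volume ((i : ℝ) / N) (((i + 1 : ℕ) : ℝ) / N))
    (hc : ∀ i < M, ∀ r ∈ Set.Icc ((i : ℝ) / N) (((i + 1 : ℕ) : ℝ) / N), |c (i + 1) - φ r| ≤ δ) :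
    |(N : ℝ)⁻¹ * ∑ i ∈ Finset.Icc 1 M, c i - ∫ r in (0 : ℝ)..(M : ℝ) / N, φ r|
      ≤ (M : ℝ) / N * δ := by
  have hN' : (0 : ℝ) < N := by exact_mod_cast hN
  have hsplit := intervalIntegral.sum_integral_adjacent_intervals
    (a := fun i : ℕ => (i : ℝ) / N) (μ := volume) (f := φ) (n := M) hφ
  simp only [Nat.cast_zero, zero_div] at hsplit
  have hsum : ∑ i ∈ Finset.Icc 1 M, c i = ∑ i ∈ Finset.range M, c (i + 1) := by
    rw [Finset.range_eq_Ico, Finset.sum_Ico_add' c 0 M 1]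
    rfl
  rw [← hsplit, hsum, Finset.mul_sum, ← Finset.sum_sub_distrib]
  have hterm : ∀ i ∈ Finset.range M,
      |(N : ℝ)⁻¹ * c (i + 1) - ∫ r in ((i : ℝ) / N)..(((i + 1 : ℕ) : ℝ) / N), φ r|
        ≤ (N : ℝ)⁻¹ * δ := by
    intro i hi
    have hi' := Finset.mem_range.1 hi
    have hle : (i : ℝ) / N ≤ ((i + 1 : ℕ) : ℝ) / N := by gcongr; simp
    have hlen : ((i + 1 : ℕ) : ℝ) / N - (i : ℝ) / N = (N : ℝ)⁻¹ := by
      push_cast; field_simp; ring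
    have heq : (N : ℝ)⁻¹ * c (i + 1) - ∫ r in ((i : ℝ) / N)..(((i + 1 : ℕ) : ℝ) / N), φ r
        = ∫ r in ((i : ℝ) / N)..(((i + 1 : ℕ) : ℝ) / N), (c (i + 1) - φ r) := by
      rw [intervalIntegral.integral_sub intervalIntegrable_const (hφ i hi'),
        intervalIntegral.integral_const, hlen, smul_eq_mul]
    rw [heq]
    have hb := intervalIntegral.norm_integral_le_of_norm_le_const
      (f := fun r => c (i + 1) - φ r) (C := δ) (a := (i : ℝ) / N) (b := ((i + 1 : ℕ) : ℝ) / N)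
      (fun r hr => by
        rw [Set.uIoc_of_le hle] at hr
        exact hc i hi' r (Set.Ioc_subset_Icc_self hr))
    rw [hlen, abs_of_pos (inv_pos.2 hN'), Real.norm_eq_abs] at hb
    linarith
  calc _ ≤ ∑ i ∈ Finset.range M, (N : ℝ)⁻¹ * δ :=
        (Finset.abs_sum_le_sum_abs _ _).trans (Finset.sum_le_sum hterm)
    _ = (M : ℝ) / N * δ := by
        rw [Finset.sum_const, Finset.card_range, nsmul_eq_mul]; ring

/-- A weighted square is stable under small perturbations of the base and of a bounded weight. -/
theorem abs_sq_mul_sub_sq_mul_le {a b k k' C D η : ℝ} (hη : η ≤ 1) (hb : |b| ≤ C)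
    (hk : |k| ≤ D) (hab : |a - b| ≤ η) (hkk : |k - k'| ≤ η) :
    |a ^ 2 * k - b ^ 2 * k'| ≤ η * ((2 * C + 1) * D + C ^ 2) := by
  have hη0 : 0 ≤ η := (abs_nonneg _).trans hab
  have hC : 0 ≤ C := (abs_nonneg _).trans hb
  have h1 : |a + b| ≤ 2 * C + 1 := by
    rw [abs_le] at *
    constructor <;> linarith
  have h2 : a ^ 2 * k - b ^ 2 * k' = (a - b) * ((a + b) * k) + b ^ 2 * (k - k') := by ring
  calc _ ≤ |a - b| * (|a + b| * |k|) + |b| ^ 2 * |k - k'| := by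
        rw [h2]
        refine (abs_add_le _ _).trans_eq ?_
        simp only [abs_mul, abs_pow]
    _ ≤ η * ((2 * C + 1) * D) + C ^ 2 * η := by gcongr
    _ = _ := by ring

/-- If the partial sums of a triangular array, scaled by `w N`, converge uniformly to a continuous
function `A`, and `θ N → ζ`, then the kernel-weighted squared scaled partial sums are uniformly
close to `A r ^ 2 * K (ζ * (r - s))` on the grid cells. -/
theorem eventually_weighted_sq_close {K : ℝ → ℝ} {L : NNReal} (hK : LipschitzWith L K) {CK : ℝ}
    (hKbd : ∀ x, |K x| ≤ CK) {θ : ℕ → ℝ} {ζ : ℝ} (hθ : Tendsto θ atTop (𝓝 ζ))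
    {A : ℝ → ℝ} (hA : ContinuousOn A (Set.Icc 0 1)) {S : ℕ → ℕ → ℝ}
    (hS : ∀ ε > (0 : ℝ), ∀ᶠ N : ℕ in atTop, ∀ s ∈ Set.Icc (0 : ℝ) 1,
      |S N ⌊(N : ℝ) * s⌋₊ - A s| < ε) {δ : ℝ} (hδ : 0 < δ) :
    ∀ᶠ N : ℕ in atTop, ∀ s ∈ Set.Icc (0 : ℝ) 1, ∀ i < ⌊(N : ℝ) * s⌋₊,
      ∀ r ∈ Set.Icc ((i : ℝ) / N) (((i + 1 : ℕ) : ℝ) / N),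
      |S N (i + 1) ^ 2 * K (θ N * (((i + 1 : ℕ) : ℝ) / N - (⌊(N : ℝ) * s⌋₊ : ℝ) / N))
        - A r ^ 2 * K (ζ * (r - s))| ≤ δ := by
  obtain ⟨C, hC⟩ := isCompact_Icc.exists_bound_of_continuousOn hA
  have hCK : 0 ≤ CK := (abs_nonneg _).trans (hKbd 0)
  have hC0 : 0 ≤ C := (norm_nonneg _).trans (hC 0 (by simp))
  set B : ℝ := (2 * C + 1) * CK + C ^ 2 with hB
  have hB0 : 0 ≤ B := by positivity
  set η : ℝ := min 1 (δ / (B + 1)) with hη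
  have hη0 : 0 < η := lt_min one_pos (by positivity)
  have hηB : η * B ≤ δ := by
    calc η * B ≤ δ / (B + 1) * (B + 1) := by
          gcongr
          · exact min_le_right _ _
          · linarith
      _ = δ := by field_simp
  have hUC := isCompact_Icc.uniformContinuousOn_of_continuous hA
  obtain ⟨ρ, hρ, hρA⟩ := Metric.uniformContinuousOn_iff.1 hUC (η / 2) (by positivity)
  have hinv : Tendsto (fun N : ℕ => (N : ℝ)⁻¹) atTop (𝓝 0) := tendsto_inv_atTop_nhds_zero_nat
  have hlip : Tendsto (fun N : ℕ => (L : ℝ) * (|θ N - ζ| + |ζ| * (2 * (N : ℝ)⁻¹))) atTop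
      (𝓝 0) := by
    have := (((hθ.sub_const ζ).abs).add ((hinv.const_mul 2).const_mul |ζ|)).const_mul (L : ℝ)
    simpa using this
  filter_upwards [hS (η / 2) (by positivity), hinv.eventually_lt_const hρ,
    hlip.eventually_lt_const hη0, eventually_gt_atTop 0] with N hSN hρN hLN hN s hs i hi r hr
  have hN' : (0 : ℝ) < N := by exact_mod_cast hN
  set M := ⌊(N : ℝ) * s⌋₊ with hM
  have hMle : (M : ℝ) ≤ N * s := Nat.floor_le (mul_nonneg hN'.le hs.1)
  have hMlt : (N : ℝ) * s < M + 1 := Nat.lt_floor_add_one _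
  have hMs : (M : ℝ) / N ≤ s := by rw [div_le_iff₀ hN']; linarith
  have hMs' : s - (M : ℝ) / N ≤ (N : ℝ)⁻¹ := by
    rw [sub_le_iff_le_add, inv_eq_one_div, ← add_div, le_div_iff₀ hN']; linarith
  have hiM : ((i + 1 : ℕ) : ℝ) / N ≤ (M : ℝ) / N := by gcongr; omega
  have hi0 : 0 ≤ (i : ℝ) / N := by positivity
  have hlen : ((i + 1 : ℕ) : ℝ) / N = (i : ℝ) / N + (N : ℝ)⁻¹ := by
    push_cast; field_simp
  have hinv0 : 0 < (N : ℝ)⁻¹ := inv_pos.2 hN'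
  set t : ℝ := ((i + 1 : ℕ) : ℝ) / N with ht
  obtain ⟨hr1, hr2⟩ := hr
  have ht1 : t ∈ Set.Icc (0 : ℝ) 1 := ⟨by linarith, by linarith [hs.2]⟩
  have hr01 : r ∈ Set.Icc (0 : ℝ) 1 := ⟨by linarith, by linarith [hs.2]⟩
  refine (abs_sq_mul_sub_sq_mul_le (min_le_left _ _) (hC r hr01) (hKbd _) ?_ ?_).trans hηB
  · have h1 := hSN t ht1
    have hfl : ⌊(N : ℝ) * t⌋₊ = i + 1 := by
      rw [ht, mul_div_cancel₀ _ hN'.ne', Nat.floor_natCast]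
    rw [hfl] at h1
    have h2 := hρA t ht1 r hr01 (by rw [Real.dist_eq, abs_lt]; constructor <;> linarith)
    rw [Real.dist_eq] at h2
    linarith [abs_sub_le (S N (i + 1)) (A t) (A r)]
  · have h1 := hK.dist_le_mul (θ N * (t - (M : ℝ) / N)) (ζ * (r - s))
    rw [Real.dist_eq, Real.dist_eq] at h1
    refine h1.trans (le_trans ?_ hLN.le)
    gcongr
    have h2 : θ N * (t - (M : ℝ) / N) - ζ * (r - s)
        = (θ N - ζ) * (t - (M : ℝ) / N) + ζ * ((t - r) + (s - (M : ℝ) / N)) := by ring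
    have h3 : |t - (M : ℝ) / N| ≤ 1 := by
      rw [abs_le]; constructor <;> linarith [hs.2, ht1.1]
    have h4 : |(t - r) + (s - (M : ℝ) / N)| ≤ 2 * (N : ℝ)⁻¹ := by
      rw [abs_le]; constructor <;> linarith
    calc _ ≤ |θ N - ζ| * |t - (M : ℝ) / N| + |ζ| * |(t - r) + (s - (M : ℝ) / N)| := by
          rw [h2, ← abs_mul, ← abs_mul]; exact abs_add_le _ _
      _ ≤ |θ N - ζ| * 1 + |ζ| * (2 * (N : ℝ)⁻¹) := by gcongr
      _ = _ := by ring

/-- The mean of the kernel-weighted squared scaled partial sums converges, uniformly in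
`s ∈ [0, 1]`, to the corresponding integral. -/
theorem weighted_sq_mean_sub_integral_isLittleO {K : ℝ → ℝ} {L : NNReal} (hK : LipschitzWith L K)
    {CK : ℝ} (hKbd : ∀ x, |K x| ≤ CK) {θ : ℕ → ℝ} {ζ : ℝ} (hθ : Tendsto θ atTop (𝓝 ζ))
    {A : ℝ → ℝ} (hA : ContinuousOn A (Set.Icc 0 1)) {S : ℕ → ℕ → ℝ}
    (hS : ∀ ε > (0 : ℝ), ∀ᶠ N : ℕ in atTop, ∀ s ∈ Set.Icc (0 : ℝ) 1,
      |S N ⌊(N : ℝ) * s⌋₊ - A s| < ε) :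
    (fun p : ℕ × ℝ => (p.1 : ℝ)⁻¹ * ∑ i ∈ Finset.Icc 1 ⌊(p.1 : ℝ) * p.2⌋₊,
        S p.1 i ^ 2 * K (θ p.1 * ((i : ℝ) / p.1 - (⌊(p.1 : ℝ) * p.2⌋₊ : ℝ) / p.1))
      - ∫ r in (0 : ℝ)..p.2, A r ^ 2 * K (ζ * (r - p.2)))
      =o[atTop ×ˢ 𝓟 (Set.Icc (0 : ℝ) 1)] (fun _ => (1 : ℝ)) := by
  obtain ⟨C, hC⟩ := isCompact_Icc.exists_bound_of_continuousOn hA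
  have hCK : 0 ≤ CK := (abs_nonneg _).trans (hKbd 0)
  have hinv : Tendsto (fun N : ℕ => C ^ 2 * CK * (N : ℝ)⁻¹) atTop (𝓝 0) := by
    simpa using (tendsto_inv_atTop_nhds_zero_nat (𝕜 := ℝ)).const_mul (C ^ 2 * CK)
  rw [isLittleO_iff]
  intro ε hε
  rw [eventually_prod_principal_iff]
  filter_upwards [eventually_weighted_sq_close hK hKbd hθ hA hS (half_pos hε),
    hinv.eventually_lt_const (half_pos hε), eventually_gt_atTop 0] with N hclose hsmall hN s hs
  have hN' : (0 : ℝ) < N := by exact_mod_cast hN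
  simp only [norm_one, mul_one, Real.norm_eq_abs]
  have hclose := hclose s hs
  set M := ⌊(N : ℝ) * s⌋₊ with hM
  have hMle : (M : ℝ) ≤ N * s := Nat.floor_le (mul_nonneg hN'.le hs.1)
  have hMlt : (N : ℝ) * s < M + 1 := Nat.lt_floor_add_one _
  have hM0 : 0 ≤ (M : ℝ) / N := by positivity
  have hMs : (M : ℝ) / N ≤ s := by rw [div_le_iff₀ hN']; linarith
  have hMs' : s - (M : ℝ) / N ≤ (N : ℝ)⁻¹ := by
    rw [sub_le_iff_le_add, inv_eq_one_div, ← add_div, le_div_iff₀ hN']; linarith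
  set φ : ℝ → ℝ := fun r => A r ^ 2 * K (ζ * (r - s)) with hφ
  have hφc : ContinuousOn φ (Set.Icc 0 1) :=
    (hA.pow 2).mul (hK.continuous.comp (by fun_prop)).continuousOn
  have hφi : ∀ a ∈ Set.Icc (0 : ℝ) 1, ∀ b ∈ Set.Icc (0 : ℝ) 1,
      IntervalIntegrable φ volume a b := fun a ha b hb =>
    (hφc.mono (Set.uIcc_subset_Icc ha hb)).intervalIntegrable
  have hgrid : ∀ i : ℕ, i ≤ M → (i : ℝ) / N ∈ Set.Icc (0 : ℝ) 1 := fun i hi =>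
    ⟨by positivity, le_trans (by gcongr) (hMs.trans hs.2)⟩
  have h1 := abs_riemann_sum_sub_integral_le hN M
    (fun i => S N i ^ 2 * K (θ N * ((i : ℝ) / N - (M : ℝ) / N))) φ (ε / 2)
    (fun i hi => hφi _ (hgrid i hi.le) _ (hgrid (i + 1) hi)) hclose
  have h2 := intervalIntegral.integral_add_adjacent_intervals
    (hφi 0 (by simp) _ (hgrid M le_rfl)) (hφi _ (hgrid M le_rfl) s hs)
  have h3 : |∫ r in (M : ℝ) / N..s, φ r| ≤ C ^ 2 * CK * (N : ℝ)⁻¹ := by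
    have hb := intervalIntegral.norm_integral_le_of_norm_le_const (f := φ) (C := C ^ 2 * CK)
      (a := (M : ℝ) / N) (b := s) (fun r hr => by
        rw [Set.uIoc_of_le hMs] at hr
        have hA' := hC r ⟨hM0.trans hr.1.le, hr.2.trans hs.2⟩
        have hK' := hKbd (ζ * (r - s))
        rw [hφ, norm_mul, norm_pow, Real.norm_eq_abs (K _)]
        gcongr)
    rw [Real.norm_eq_abs, abs_of_nonneg (sub_nonneg.2 hMs)] at hb
    exact hb.trans (by gcongr)
  have h4 : (M : ℝ) / N * (ε / 2) ≤ ε / 2 :=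
    mul_le_of_le_one_left (half_pos hε).le (hMs.trans hs.2)
  rw [← h2]
  rw [abs_le] at h1 h3 ⊢
  constructor <;> linarith [h1.1, h1.2, h3.1, h3.2]

/-- The reciprocal of the discretised time `⌊N s⌋ / N` is uniformly close to `1 / s` for `s`
bounded away from zero. -/
theorem inv_floor_div_sub_inv_isLittleO {κ : ℝ} (hκ : 0 < κ) :
    (fun p : ℕ × ℝ => ((⌊(p.1 : ℝ) * p.2⌋₊ : ℝ) / p.1)⁻¹ - p.2⁻¹)
      =o[atTop ×ˢ 𝓟 (Set.Icc κ 1)] (fun _ => (1 : ℝ)) := by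
  have hinv := tendsto_inv_atTop_nhds_zero_nat (𝕜 := ℝ)
  rw [isLittleO_iff]
  intro ε hε
  rw [eventually_prod_principal_iff]
  filter_upwards [hinv.eventually_lt_const (half_pos hκ),
    hinv.eventually_lt_const (show 0 < ε * (κ / 2 * κ) by positivity),
    eventually_gt_atTop 0] with N h1 h2 hN s hs
  have hN' : (0 : ℝ) < N := by exact_mod_cast hN
  have hs0 : 0 < s := hκ.trans_le hs.1
  simp only [norm_one, mul_one, Real.norm_eq_abs]
  have hMle : (⌊(N : ℝ) * s⌋₊ : ℝ) ≤ N * s := Nat.floor_le (mul_nonneg hN'.le hs0.le)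
  have hMlt : (N : ℝ) * s < ⌊(N : ℝ) * s⌋₊ + 1 := Nat.lt_floor_add_one _
  set x : ℝ := (⌊(N : ℝ) * s⌋₊ : ℝ) / N with hx
  have hxs : x ≤ s := by rw [hx, div_le_iff₀ hN']; linarith
  have hxs' : s - x ≤ (N : ℝ)⁻¹ := by
    rw [hx, sub_le_iff_le_add, inv_eq_one_div, ← add_div, le_div_iff₀ hN']; linarith
  have hxκ : κ / 2 ≤ x := by linarith [hs.1]
  have hx0 : 0 < x := by linarith
  rw [inv_sub_inv hx0.ne' hs0.ne', abs_of_nonneg (div_nonneg (by linarith) (by positivity)),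
    div_le_iff₀ (by positivity)]
  calc s - x ≤ ε * (κ / 2 * κ) := by linarith
    _ ≤ ε * (x * s) := by
        have := hs.1
        gcongr


/-- `K` Lipschitz and bounded, `N/h_N → ζ ∈ [1,∞)`, `κ ∈ (0,1)`,
`A : [0,1] → ℝ` continuous, and `(y_{N,i})` a triangular array with
`sup_{s∈[0,1]} |N^{−3/2} ∑_{j=1}^{⌊Ns⌋} y_{N,j} − A(s)| → 0`. Then
`sup_{s∈[κ,1]} |⌊Ns⌋^{−3} ∑_{i=1}^{⌊Ns⌋} (∑_{j=1}^i y_{N,j})² K_{h_N}(i − ⌊Ns⌋)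
  − s^{−3} ζ ∫_0^s A(r)² K(ζ(r − s)) dr| → 0`, where `K_h(x) = K(x/h)/h`. -/
theorem variance_ratio_numerator_I1 (K : ℝ → ℝ) (L : NNReal)
    (hK : LipschitzWith L K) (CK : ℝ) (hKbd : ∀ x, |K x| ≤ CK)
    (h : ℕ → ℝ) (hpos : ∀ N, 0 < h N) (ζ : ℝ) (hζ : 1 ≤ ζ)
    (hconv : Filter.Tendsto (fun N : ℕ => (N : ℝ) / h N) Filter.atTop (nhds ζ))
    (κ : ℝ) (hκ : κ ∈ Set.Ioo (0 : ℝ) 1)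
    (A : ℝ → ℝ) (hA : ContinuousOn A (Set.Icc (0 : ℝ) 1))
    (y : ℕ → ℕ → ℝ)
    (hy : ∀ ε > (0 : ℝ), ∃ N₀ : ℕ, ∀ N : ℕ, N₀ ≤ N → ∀ s ∈ Set.Icc (0 : ℝ) 1,
      |(N : ℝ) ^ (-(3 / 2) : ℝ) * ∑ j ∈ Finset.Icc 1 ⌊(N : ℝ) * s⌋.toNat, y N j - A s| < ε) :
    ∀ ε > (0 : ℝ), ∃ N₀ : ℕ, ∀ N : ℕ, N₀ ≤ N → ∀ s ∈ Set.Icc κ 1,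
      |((⌊(N : ℝ) * s⌋.toNat : ℝ) ^ 3)⁻¹ *
          (∑ i ∈ Finset.Icc 1 ⌊(N : ℝ) * s⌋.toNat,
            (∑ j ∈ Finset.Icc 1 i, y N j) ^ 2 *
              (K (((i : ℝ) - (⌊(N : ℝ) * s⌋.toNat : ℝ)) / h N) / h N)) -
        (s ^ 3)⁻¹ * ζ * ∫ r in (0 : ℝ)..s, (A r) ^ 2 * K (ζ * (r - s))| < ε := by
  set θ : ℕ → ℝ := fun N => (N : ℝ) / h N with hθ
  set S : ℕ → ℕ → ℝ := fun N i => (N : ℝ) ^ (-(3 / 2) : ℝ) * ∑ j ∈ Finset.Icc 1 i, y N j with hS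
  have hS' : ∀ ε > (0 : ℝ), ∀ᶠ N : ℕ in atTop, ∀ s ∈ Set.Icc (0 : ℝ) 1,
      |S N ⌊(N : ℝ) * s⌋₊ - A s| < ε := fun ε hε => by
    simpa only [Int.floor_toNat] using eventually_atTop.2 (hy ε hε)
  set l : Filter (ℕ × ℝ) := atTop ×ˢ 𝓟 (Set.Icc κ 1) with hl
  have hmem : ∀ᶠ p in l, p.2 ∈ Set.Icc κ 1 := by
    rw [hl, eventually_prod_principal_iff]
    exact Eventually.of_forall fun _ s hs => hs
  have hmean := (weighted_sq_mean_sub_integral_isLittleO hK hKbd hconv hA hS').mono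
    (prod_mono le_rfl (principal_mono.2 (Set.Icc_subset_Icc_left hκ.1.le)) :
      l ≤ atTop ×ˢ 𝓟 (Set.Icc (0 : ℝ) 1))
  have hrate : (fun p : ℕ × ℝ => θ p.1 - ζ) =o[l] (fun _ => (1 : ℝ)) := by
    rw [isLittleO_one_iff]
    rw [← sub_self ζ]
    exact (hconv.sub_const ζ).comp tendsto_fst
  have hinv := inv_floor_div_sub_inv_isLittleO hκ.1
  have binv : (fun p : ℕ × ℝ => p.2⁻¹) =O[l] (fun _ => (1 : ℝ)) := by
    refine IsBigO.of_bound κ⁻¹ (hmem.mono fun p hp => ?_)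
    have hp0 : 0 < p.2 := hκ.1.trans_le hp.1
    rw [norm_one, mul_one, Real.norm_eq_abs, abs_of_pos (inv_pos.2 hp0)]
    exact inv_anti₀ hκ.1 hp.1
  have bζ : (fun _ : ℕ × ℝ => ζ) =O[l] (fun _ => (1 : ℝ)) := isBigO_const_const _ one_ne_zero _
  have bint : (fun p : ℕ × ℝ => ∫ r in (0 : ℝ)..p.2, A r ^ 2 * K (ζ * (r - p.2)))
      =O[l] (fun _ => (1 : ℝ)) := by
    obtain ⟨C, hC⟩ := isCompact_Icc.exists_bound_of_continuousOn hA
    have hCK : 0 ≤ CK := (abs_nonneg _).trans (hKbd 0)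
    refine IsBigO.of_bound (C ^ 2 * CK) (hmem.mono fun p hp => ?_)
    have hp0 : 0 < p.2 := hκ.1.trans_le hp.1
    have hb := intervalIntegral.norm_integral_le_of_norm_le_const
      (f := fun r => A r ^ 2 * K (ζ * (r - p.2))) (C := C ^ 2 * CK) (a := 0) (b := p.2)
      (fun r hr => by
        rw [Set.uIoc_of_le hp0.le] at hr
        have hA' := hC r ⟨hr.1.le, hr.2.trans hp.2⟩
        have hK' := hKbd (ζ * (r - p.2))
        rw [norm_mul, norm_pow, Real.norm_eq_abs (K _)]
        gcongr)
    rw [sub_zero, abs_of_pos hp0] at hb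
    rw [norm_one]
    exact hb.trans (by gcongr; exact hp.2)
  have binv₂ : (fun p : ℕ × ℝ => p.2⁻¹ * p.2⁻¹) =O[l] (fun _ => (1 : ℝ)) := by
    simpa only [mul_one] using binv.mul binv
  have binv₃ : (fun p : ℕ × ℝ => p.2⁻¹ * (p.2⁻¹ * p.2⁻¹)) =O[l] (fun _ => (1 : ℝ)) := by
    simpa only [mul_one] using binv.mul binv₂
  have binvζ : (fun p : ℕ × ℝ => p.2⁻¹ * (p.2⁻¹ * p.2⁻¹) * ζ) =O[l] (fun _ => (1 : ℝ)) := by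
    simpa only [mul_one] using binv₃.mul bζ
  have hcube := isLittleO_one_mul_sub_mul hinv
    (isLittleO_one_mul_sub_mul hinv hinv binv binv) binv binv₂
  have hmain := isLittleO_one_mul_sub_mul (isLittleO_one_mul_sub_mul hcube hrate binv₃ bζ)
    hmean binvζ bint
  intro ε hε
  have hfin := isLittleO_iff.1 hmain (half_pos hε)
  rw [eventually_prod_principal_iff] at hfin
  refine eventually_atTop.1 ?_
  filter_upwards [hfin, eventually_gt_atTop 0] with N hbound hN s hs
  have hN' : (0 : ℝ) < N := by exact_mod_cast hN
  have hb := hbound s hs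
  simp only [norm_one, mul_one, Real.norm_eq_abs] at hb
  refine lt_of_eq_of_lt ?_ (hb.trans_lt (half_lt_self hε))
  rw [Int.floor_toNat]
  set M := ⌊(N : ℝ) * s⌋₊ with hM
  have hh := (hpos N).ne'
  have hpow : ((N : ℝ) ^ (-(3 / 2) : ℝ)) ^ 2 = ((N : ℝ) ^ 3)⁻¹ := by
    rw [← Real.rpow_natCast, ← Real.rpow_mul hN'.le, ← Real.rpow_natCast, ← Real.rpow_neg hN'.le]
    norm_num
  have harg : ∀ i : ℕ, θ N * ((i : ℝ) / N - (M : ℝ) / N) = ((i : ℝ) - M) / h N := fun i => by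
    rw [hθ]; field_simp
  have hsum : ∑ i ∈ Finset.Icc 1 M, (∑ j ∈ Finset.Icc 1 i, y N j) ^ 2 *
        (K (((i : ℝ) - (M : ℝ)) / h N) / h N)
      = (N : ℝ) ^ 3 * (h N)⁻¹ * ∑ i ∈ Finset.Icc 1 M,
        S N i ^ 2 * K (θ N * ((i : ℝ) / N - (M : ℝ) / N)) := by
    rw [Finset.mul_sum]
    refine Finset.sum_congr rfl fun i _ => ?_
    rw [harg, hS, mul_pow, hpow]
    field_simp
  rw [hsum]
  congr 1
  congr 1
  · simp only [hθ, inv_div]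
    field_simp
  · ring
end

section
/- Let κ ∈ (0,1), let b : [0,1] → ℝ be continuous, and let (y_{N,i}), 0 ≤ i ≤ N, be a triangular array of reals with y_{N,0} = 0 such that sup_{s∈[0,1]} | N^{−1/2} y_{N,⌊Ns⌋} − b(s) | → 0 as N → ∞. Then sup_{s∈[κ,1]} | ⌊Ns⌋^{−2} ∑_{i=1}^{⌊Ns⌋} y_{N,i}^2 − s^{−2} ∫_0^s b(r)^2 dr | → 0 as N → ∞. -/
open Set

/-- Error bound for a right-endpoint Riemann sum over a uniform grid with perturbed values. -/
theorem abs_riemannSum_sub_integral_le {f : ℝ → ℝ} (hf : ContinuousOn f (Icc 0 1)) {N : ℕ}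
    (hN : 0 < N) {a : ℕ → ℝ} {η : ℝ}
    (h : ∀ i < N, ∀ r ∈ Icc ((i : ℝ) / N) ((i + 1 : ℕ) / N), |a (i + 1) - f r| ≤ η)
    {n : ℕ} (hn : n ≤ N) :
    |(N : ℝ)⁻¹ * ∑ i ∈ Finset.Icc 1 n, a i - ∫ r in (0 : ℝ)..n / N, f r| ≤ η * (n / N) := by
  have hN' : (0 : ℝ) < N := by exact_mod_cast hN
  have hint : ∀ {u v : ℝ}, u ∈ Icc (0 : ℝ) 1 → v ∈ Icc (0 : ℝ) 1 →
      IntervalIntegrable f MeasureTheory.volume u v := fun hu hv =>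
    (hf.mono (ordConnected_Icc.uIcc_subset hu hv)).intervalIntegrable
  have hmem : ∀ {k : ℕ}, k ≤ N → (k / N : ℝ) ∈ Icc (0 : ℝ) 1 := fun hk =>
    ⟨by positivity, div_le_one_of_le₀ (by exact_mod_cast hk) hN'.le⟩
  induction n with
  | zero => simp
  | succ n ih =>
    have ih := ih (by lia)
    have hstep : ((n + 1 : ℕ) : ℝ) / N - n / N = (N : ℝ)⁻¹ := by push_cast; field_simp; ring
    have hle : (n : ℝ) / N ≤ (n + 1 : ℕ) / N := by
      rw [← sub_nonneg, hstep]; positivity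
    have hcell : |(N : ℝ)⁻¹ * a (n + 1) - ∫ r in (n / N : ℝ)..(n + 1 : ℕ) / N, f r|
        ≤ η * (N : ℝ)⁻¹ := by
      have hsub : (N : ℝ)⁻¹ * a (n + 1) - ∫ r in (n / N : ℝ)..(n + 1 : ℕ) / N, f r
          = ∫ r in (n / N : ℝ)..(n + 1 : ℕ) / N, (a (n + 1) - f r) := by
        rw [intervalIntegral.integral_sub intervalIntegrable_const
          (hint (hmem (by lia)) (hmem hn)), intervalIntegral.integral_const, hstep, smul_eq_mul]
      have hbound := intervalIntegral.norm_integral_le_of_norm_le_const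
        (a := (n / N : ℝ)) (b := (n + 1 : ℕ) / N) (f := fun r => a (n + 1) - f r) (C := η)
        fun r hr => h n hn r (Ioc_subset_Icc_self (uIoc_of_le hle ▸ hr))
      rw [hstep, abs_of_nonneg (by positivity : (0 : ℝ) ≤ (N : ℝ)⁻¹)] at hbound
      rwa [hsub]
    have hsplit := intervalIntegral.integral_add_adjacent_intervals
      (hint (hmem (Nat.zero_le N)) (hmem (by lia : n ≤ N))) (hint (hmem (by lia)) (hmem hn))
    rw [Nat.cast_zero, zero_div] at hsplit
    rw [Finset.sum_Icc_succ_top (by lia), ← hsplit, mul_add, add_sub_add_comm]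
    calc _ ≤ η * (n / N) + η * (N : ℝ)⁻¹ := (abs_add_le _ _).trans (add_le_add ih hcell)
      _ = _ := by rw [← hstep]; ring

/-- `t ↦ t⁻² ∫₀ᵗ f` is continuous away from zero. -/
theorem continuousOn_inv_sq_mul_integral {f : ℝ → ℝ} (hf : ContinuousOn f (Icc 0 1)) {c : ℝ}
    (hc : 0 < c) :
    ContinuousOn (fun t : ℝ => (t ^ 2)⁻¹ * ∫ r in (0 : ℝ)..t, f r) (Icc c 1) := by
  have hprim : ContinuousOn (fun t : ℝ => ∫ r in (0 : ℝ)..t, f r) (Icc 0 1) := by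
    have h := intervalIntegral.continuousOn_primitive_interval (μ := MeasureTheory.volume)
      (f := f) (a := 0) (b := 1)
    rw [uIcc_of_le zero_le_one] at h
    exact h hf.integrableOn_Icc
  refine ContinuousOn.mul (ContinuousOn.inv₀ (by fun_prop) fun t ht => ?_)
    (hprim.mono (Icc_subset_Icc_left hc.le))
  exact pow_ne_zero 2 (hc.trans_le ht.1).ne'

/-- For continuous `b` on `[0, 1]`, if `u` is near `r` and `x` is near `b u`, then `x ^ 2` is near
`b r ^ 2`, uniformly in all variables. -/
theorem exists_abs_sq_sub_sq_le {b : ℝ → ℝ} (hb : ContinuousOn b (Icc 0 1)) {η : ℝ} (hη : 0 < η) :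
    ∃ δ > 0, ∀ x, ∀ u ∈ Icc (0 : ℝ) 1, ∀ r ∈ Icc (0 : ℝ) 1, |u - r| < δ → |x - b u| < δ →
      |x ^ 2 - b r ^ 2| ≤ η := by
  obtain ⟨M, hM⟩ := isCompact_Icc.exists_bound_of_continuousOn hb
  have hM0 : 0 ≤ M := (norm_nonneg _).trans (hM 0 (by simp))
  set ρ := min 1 (η / (2 * M + 2))
  have hρ0 : 0 < ρ := lt_min one_pos (by positivity)
  have hρη : ρ * (2 * M + 2) ≤ η := (le_div_iff₀ (by positivity)).1 (min_le_right _ _)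
  have hρ1 : ρ ≤ 1 := min_le_left _ _
  obtain ⟨δ, hδ, hδb⟩ := Metric.uniformContinuousOn_iff.1
    (isCompact_Icc.uniformContinuousOn_of_continuous hb) (ρ / 2) (by positivity)
  refine ⟨min δ (ρ / 2), by positivity, fun x u hu r hr hur hx => ?_⟩
  have hbur : |b u - b r| < ρ / 2 := hδb u hu r hr (hur.trans_le (min_le_left _ _))
  have hxu : |x - b u| < ρ / 2 := hx.trans_le (min_le_right _ _)
  have hxr : |x - b r| ≤ ρ := by
    have := abs_sub_le x (b u) (b r)
    linarith
  have hbr : |b r| ≤ M := hM r hr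
  have hsum : |x + b r| ≤ 2 * M + 2 := by
    rw [abs_le] at *
    constructor <;> linarith
  calc |x ^ 2 - b r ^ 2| = |x - b r| * |x + b r| := by rw [← abs_mul]; ring_nf
    _ ≤ ρ * (2 * M + 2) := by gcongr
    _ ≤ η := hρη

/-- `κ ∈ (0,1)`, `b : [0,1] → ℝ` continuous, `(y_{N,i})` a triangular
array with `y_{N,0} = 0` and `sup_{s∈[0,1]} |N^{−1/2} y_{N,⌊Ns⌋} − b(s)| → 0`. Then
`sup_{s∈[κ,1]} |⌊Ns⌋^{−2} ∑_{i=1}^{⌊Ns⌋} y_{N,i}² − s^{−2} ∫_0^s b(r)² dr| → 0`. -/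
theorem variance_ratio_denominator_I1 (κ : ℝ) (hκ : κ ∈ Set.Ioo (0 : ℝ) 1)
    (b : ℝ → ℝ) (hb : ContinuousOn b (Set.Icc (0 : ℝ) 1))
    (y : ℕ → ℕ → ℝ) (hy0 : ∀ N, y N 0 = 0)
    (hy : ∀ ε > (0 : ℝ), ∃ N₀ : ℕ, ∀ N : ℕ, N₀ ≤ N → ∀ s ∈ Set.Icc (0 : ℝ) 1,
      |(N : ℝ) ^ (-(1 / 2) : ℝ) * y N ⌊(N : ℝ) * s⌋.toNat - b s| < ε) :
    ∀ ε > (0 : ℝ), ∃ N₀ : ℕ, ∀ N : ℕ, N₀ ≤ N → ∀ s ∈ Set.Icc κ 1,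
      |((⌊(N : ℝ) * s⌋.toNat : ℝ) ^ 2)⁻¹ *
          (∑ i ∈ Finset.Icc 1 ⌊(N : ℝ) * s⌋.toNat, (y N i) ^ 2) -
        (s ^ 2)⁻¹ * ∫ r in (0 : ℝ)..s, (b r) ^ 2| < ε := by
  intro ε hε
  obtain ⟨hκ0, hκ1⟩ := hκ
  have hb2 : ContinuousOn (fun r => b r ^ 2) (Icc 0 1) := hb.pow 2
  obtain ⟨δ, hδ, hsq⟩ := exists_abs_sq_sub_sq_le hb (η := ε * κ ^ 2 / 8) (by positivity)
  obtain ⟨θ, hθ, hunif⟩ := Metric.uniformContinuousOn_iff.1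
    (isCompact_Icc.uniformContinuousOn_of_continuous
      (continuousOn_inv_sq_mul_integral hb2 (half_pos hκ0))) (ε / 2) (by positivity)
  obtain ⟨N₁, hN₁⟩ := hy δ hδ
  obtain ⟨N₂, hN₂⟩ := exists_nat_one_div_lt (lt_min (lt_min hδ hθ) (half_pos hκ0))
  refine ⟨max N₁ (N₂ + 1), fun N hN s hs => ?_⟩
  have hNpos : 0 < N := by lia
  have hN' : (0 : ℝ) < N := by exact_mod_cast hNpos
  have hinv : (N : ℝ)⁻¹ < min (min δ θ) (κ / 2) := by
    refine lt_of_le_of_lt ?_ hN₂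
    rw [one_div]
    have : (N₂ : ℝ) + 1 ≤ N := by exact_mod_cast (le_max_right _ _).trans hN
    gcongr
  obtain ⟨hinv, hinvκ⟩ := lt_min_iff.1 hinv
  obtain ⟨hinvδ, hinvθ⟩ := lt_min_iff.1 hinv
  have hs0 : 0 ≤ s := hκ0.le.trans hs.1
  rw [Int.floor_toNat]
  set n := ⌊(N : ℝ) * s⌋₊
  have hnle : (n : ℝ) ≤ N * s := Nat.floor_le (by positivity)
  have hnlt : (N : ℝ) * s < n + 1 := Nat.lt_floor_add_one _
  have hnN : n ≤ N := by
    have : (n : ℝ) ≤ N := hnle.trans (mul_le_of_le_one_right hN'.le hs.2)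
    exact_mod_cast this
  have hts : (n : ℝ) / N ≤ s := by rwa [div_le_iff₀' hN']
  have hst : s < n / N + (N : ℝ)⁻¹ := by
    rw [← one_div, ← add_div, lt_div_iff₀' hN']
    exact hnlt
  have htκ : κ / 2 ≤ (n : ℝ) / N := by linarith [hs.1]
  have hriem := abs_riemannSum_sub_integral_le hb2 hNpos (a := fun i => (N : ℝ)⁻¹ * y N i ^ 2)
    (η := ε * κ ^ 2 / 8) (fun i hi r hr => by
      have hu : ((i + 1 : ℕ) / N : ℝ) ∈ Icc (0 : ℝ) 1 :=
        ⟨by positivity, div_le_one_of_le₀ (by exact_mod_cast hi) hN'.le⟩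
      have hcell : ((i + 1 : ℕ) / N : ℝ) = i / N + (N : ℝ)⁻¹ := by push_cast; field_simp
      have hr0 : (0 : ℝ) ≤ i / N := by positivity
      have hclose := hN₁ N ((le_max_left _ _).trans hN) _ hu
      rw [mul_div_cancel₀ _ hN'.ne', Int.floor_natCast, Int.toNat_natCast] at hclose
      have hpow : ((N : ℝ) ^ (-(1 / 2) : ℝ)) ^ 2 = (N : ℝ)⁻¹ := by
        rw [← Real.rpow_natCast, ← Real.rpow_mul hN'.le, ← Real.rpow_neg_one]
        norm_num
      have := hsq _ _ hu r ⟨hr0.trans hr.1, hr.2.trans hu.2⟩ (by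
        rw [abs_of_nonneg (by linarith [hr.2])]
        linarith [hr.1]) hclose
      rwa [mul_pow, hpow] at this) hnN
  have hcont := hunif ((n : ℝ) / N) ⟨htκ, hts.trans hs.2⟩ s ⟨by linarith [hs.1], hs.2⟩ (by
    rw [Real.dist_eq, abs_sub_comm, abs_of_nonneg (by linarith)]
    linarith)
  rw [Real.dist_eq] at hcont
  set t := (n : ℝ) / N with ht
  have ht0 : 0 < t := by linarith
  have hscale : ((n : ℝ) ^ 2)⁻¹ * ∑ i ∈ Finset.Icc 1 n, y N i ^ 2
      = (t ^ 2)⁻¹ * ((N : ℝ)⁻¹ * ∑ i ∈ Finset.Icc 1 n, (N : ℝ)⁻¹ * y N i ^ 2) := by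
    rw [← Finset.mul_sum, ht]
    field_simp
  have hsum : |(t ^ 2)⁻¹ * ((N : ℝ)⁻¹ * ∑ i ∈ Finset.Icc 1 n, (N : ℝ)⁻¹ * y N i ^ 2)
      - (t ^ 2)⁻¹ * ∫ r in (0 : ℝ)..t, b r ^ 2| ≤ ε / 2 := by
    rw [← mul_sub, abs_mul, abs_of_pos (by positivity), inv_mul_le_iff₀ (by positivity)]
    have ht1 : t ≤ 1 := hts.trans hs.2
    have htsq : (κ / 2) ^ 2 ≤ t ^ 2 := by gcongr
    calc _ ≤ ε * κ ^ 2 / 8 * t := hriem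
      _ ≤ ε * κ ^ 2 / 8 * 1 := by gcongr
      _ = (κ / 2) ^ 2 * (ε / 2) := by ring
      _ ≤ t ^ 2 * (ε / 2) := by gcongr
  rw [hscale]
  calc _ ≤ _ := abs_sub_le _ ((t ^ 2)⁻¹ * ∫ r in (0 : ℝ)..t, b r ^ 2) _
    _ < ε / 2 + ε / 2 := add_lt_add_of_le_of_lt hsum hcont
    _ = ε := add_halves ε
end

section
/- Let K : ℝ → ℝ be Lipschitz continuous and bounded, let (h_N) be a sequence of positive reals with N/h_N → ζ as N → ∞ for some ζ ∈ [1,∞), and let κ ∈ (0,1). Let b : [0,1] → ℝ be continuous with ∫_0^κ b(t)^2 dt > 0, and let (y_{N,i}), 0 ≤ i ≤ N, be a triangular array of reals with y_{N,0} = 0 such that sup_{s∈[0,1]} | N^{−1/2} y_{N,⌊Ns⌋} − b(s) | → 0 as N → ∞. Define U_N(s) = [ ⌊Ns⌋^{−3} ∑_{i=1}^{⌊Ns⌋} ( ∑_{j=1}^{i} y_{N,j} )^2 K_{h_N}(i − ⌊Ns⌋) ] / [ ⌊Ns⌋^{−2} ∑_{j=1}^{⌊Ns⌋} y_{N,j}^2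 ] and 𝒰(s) = ζ s^{−1} ∫_0^s K(ζ(r − s)) ( ∫_0^r b(t) dt )^2 dr / ∫_0^s b(r)^2 dr. Then for all sufficiently large N the denominator of U_N(s) is positive for every s ∈ [κ,1], and sup_{s∈[κ,1]} | U_N(s) − 𝒰(s) | → 0 as N → ∞. -/
open Filter Topology Set

/-- The filter on pairs `(x, i)` which controls the first component by `l` and is uniform over
all indices `i ≤ N x`. -/
def uniformIndexFilter {ι : Type*} (l : Filter ι) (N : ι → ℕ) : Filter (ι × ℕ) :=
  comap Prod.fst l ⊓ 𝓟 {p | p.2 ≤ N p.1}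

section uniformIndexFilter

variable {ι : Type*} {l : Filter ι} {N : ι → ℕ}

lemma eventually_uniformIndexFilter {P : ι × ℕ → Prop} :
    (∀ᶠ p in uniformIndexFilter l N, P p) ↔ ∀ᶠ x in l, ∀ i ≤ N x, P (x, i) := by
  unfold uniformIndexFilter
  rw [eventually_inf_principal, eventually_comap]
  refine eventually_congr (Eventually.of_forall fun x => ?_)
  constructor
  · intro hx i hi
    exact hx (x, i) rfl hi
  · rintro hx ⟨x', i⟩ rfl hi
    exact hx i hi

lemma tendsto_fst_uniformIndexFilter : Tendsto Prod.fst (uniformIndexFilter l N) l :=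
  tendsto_comap.mono_left inf_le_left

lemma tendsto_prodMk_uniformIndexFilter {n : ι → ℕ} (hn : ∀ᶠ x in l, n x ≤ N x) :
    Tendsto (fun x => (x, n x)) l (uniformIndexFilter l N) := by
  unfold uniformIndexFilter
  rw [tendsto_inf, tendsto_comap_iff, tendsto_principal]
  exact ⟨tendsto_id, hn⟩

lemma eventually_div_mem_Icc :
    ∀ᶠ p in uniformIndexFilter l N, (p.2 : ℝ) / N p.1 ∈ Icc (0 : ℝ) 1 := by
  rw [eventually_uniformIndexFilter]
  refine Eventually.of_forall fun x i hi => ⟨by positivity, ?_⟩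
  exact div_le_one_of_le₀ (by exact_mod_cast hi) (by positivity)

/-- Uniform Riemann sums with uniformly perturbed sample values. -/
lemma tendsto_riemann_sum_sub_integral (hN : Tendsto N l atTop) {g : ℝ → ℝ} (hg : Continuous g)
    {a : ι → ℕ → ℝ}
    (ha : Tendsto (fun p : ι × ℕ => a p.1 p.2 - g (p.2 / N p.1)) (uniformIndexFilter l N) (𝓝 0)) :
    Tendsto (fun p : ι × ℕ => (N p.1 : ℝ)⁻¹ * ∑ i ∈ Finset.Icc 1 p.2, a p.1 i -
      ∫ r in (0 : ℝ)..(p.2 / N p.1), g r) (uniformIndexFilter l N) (𝓝 0) := by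
  rw [Metric.tendsto_nhds] at ha ⊢
  intro ε hε
  have hε' : 0 < ε / 4 := by positivity
  have ha' := eventually_uniformIndexFilter.1 (ha _ hε')
  obtain ⟨δ, hδ, hgδ⟩ := Metric.uniformContinuousOn_iff.1
    ((isCompact_Icc (a := (0 : ℝ)) (b := 1)).uniformContinuousOn_of_continuous hg.continuousOn)
    (ε / 4) hε'
  have hNδ : ∀ᶠ x in l, (N x : ℝ)⁻¹ < δ :=
    (tendsto_inv_atTop_nhds_zero_nat.comp hN).eventually_lt_const hδ
  rw [eventually_uniformIndexFilter]
  filter_upwards [ha', hNδ, hN.eventually_ge_atTop 1] with x hax hδx hx1 n hn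
  have hNpos : (0 : ℝ) < N x := by exact_mod_cast hx1
  simp only [Real.dist_eq, sub_zero] at hax ⊢
  have key : ∀ m ≤ N x, |(N x : ℝ)⁻¹ * ∑ i ∈ Finset.Icc 1 m, a x i -
      ∫ r in (0 : ℝ)..(m / N x), g r| ≤ m * (ε / 2 * (N x : ℝ)⁻¹) := by
    intro m
    induction m with
    | zero => simp
    | succ m ih =>
      intro hm
      have ih' := ih (by omega)
      have hle : (m : ℝ) / N x ≤ ((m + 1 : ℕ) : ℝ) / N x := by
        gcongr
        simp
      have h1 : ((m + 1 : ℕ) : ℝ) / N x ≤ 1 := by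
        rw [div_le_one hNpos]
        exact_mod_cast hm
      have h0 : 0 ≤ (m : ℝ) / N x := by positivity
      have hlen : ((m + 1 : ℕ) : ℝ) / N x - m / N x = (N x : ℝ)⁻¹ := by
        push_cast
        field_simp
        ring
      have hstep : |∫ r in ((m : ℝ) / N x)..(((m + 1 : ℕ) : ℝ) / N x), (a x (m + 1) - g r)| ≤
          ε / 2 * (N x : ℝ)⁻¹ := by
        have := intervalIntegral.norm_integral_le_of_norm_le_const (C := ε / 2)
          (f := fun r => a x (m + 1) - g r) (a := (m : ℝ) / N x)
          (b := ((m + 1 : ℕ) : ℝ) / N x) ?_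
        · rwa [hlen, abs_of_pos (inv_pos.2 hNpos)] at this
        · intro r hr
          rw [uIoc_of_le hle] at hr
          have e1 := hax (m + 1) hm
          have e2 := hgδ (((m + 1 : ℕ) : ℝ) / N x) ⟨h0.trans hle, h1⟩ r
            ⟨h0.trans hr.1.le, hr.2.trans h1⟩ (by
              rw [Real.dist_eq, abs_of_nonneg (by linarith [hr.2])]
              linarith [hr.1])
          rw [Real.dist_eq] at e2
          rw [Real.norm_eq_abs]
          have := abs_sub_le (a x (m + 1)) (g (((m + 1 : ℕ) : ℝ) / N x)) (g r)
          linarith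
      rw [intervalIntegral.integral_sub (by simp) (hg.intervalIntegrable _ _),
        intervalIntegral.integral_const, hlen, smul_eq_mul] at hstep
      rw [Finset.sum_Icc_succ_top (by omega),
        ← intervalIntegral.integral_add_adjacent_intervals (hg.intervalIntegrable 0 (m / N x))
          (hg.intervalIntegrable _ _)]
      rw [show ((m + 1 : ℕ) : ℝ) * (ε / 2 * (N x : ℝ)⁻¹) =
        m * (ε / 2 * (N x : ℝ)⁻¹) + ε / 2 * (N x : ℝ)⁻¹ by push_cast; ring]
      refine le_trans (le_of_eq (congrArg abs ?_)) ((abs_add_le _ _).trans (add_le_add ih' hstep))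
      ring
  refine (key n hn).trans_lt ?_
  have : (n : ℝ) * (N x : ℝ)⁻¹ ≤ 1 := by
    rw [← div_eq_mul_inv, div_le_one hNpos]
    exact_mod_cast hn
  nlinarith

lemma tendsto_mul_sub_mul_of_tendsto_sub {g k : ℝ → ℝ} (hg : Continuous g) (hk : Continuous k)
    {a c : ι × ℕ → ℝ}
    (ha : Tendsto (fun p : ι × ℕ => a p - g (p.2 / N p.1)) (uniformIndexFilter l N) (𝓝 0))
    (hc : Tendsto (fun p : ι × ℕ => c p - k (p.2 / N p.1)) (uniformIndexFilter l N) (𝓝 0)) :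
    Tendsto (fun p : ι × ℕ => a p * c p - g (p.2 / N p.1) * k (p.2 / N p.1))
      (uniformIndexFilter l N) (𝓝 0) := by
  have hbdd : ∀ f : ℝ → ℝ, Continuous f →
      IsBoundedUnder (· ≤ ·) (uniformIndexFilter l N)
        (fun p : ι × ℕ => ‖f (p.2 / N p.1)‖) := by
    intro f hf
    obtain ⟨C, hC⟩ := (isCompact_Icc (a := (0 : ℝ)) (b := 1)).exists_bound_of_continuousOn
      hf.continuousOn
    exact isBoundedUnder_of_eventually_le (eventually_div_mem_Icc.mono fun p hp => hC _ hp)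
  have h1 := ha.mul hc
  have h2 := hc.zero_mul_isBoundedUnder_le (hbdd g hg)
  have h3 := ha.zero_mul_isBoundedUnder_le (hbdd k hk)
  have := (h1.add h2).add h3
  simp only [mul_zero, add_zero] at this
  refine this.congr fun p => ?_
  ring

end uniformIndexFilter

lemma IsCompact.eventually_forall_mem {ι α : Type*} [TopologicalSpace α] {l : Filter ι} {S : Set α}
    (hS : IsCompact S) {P : ι × α → Prop}
    (h : ∀ x ∈ S, ∀ᶠ p in l ×ˢ 𝓝[S] x, P p) : ∀ᶠ i in l, ∀ x ∈ S, P (i, x) := by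
  refine hS.induction_on (p := fun t => ∀ᶠ i in l, ∀ x ∈ t, P (i, x)) (by simp) ?_ ?_ ?_
  · intro s t hst ht
    exact ht.mono fun i hi x hx => hi x (hst hx)
  · intro s t hs ht
    filter_upwards [hs, ht] with i h1 h2 x hx
    exact hx.elim (h1 x) (h2 x)
  · intro x hx
    obtain ⟨u, hu, v, hv, huv⟩ := eventually_prod_iff.1 (h x hx)
    exact ⟨{y | v y}, hv, hu.mono fun i hi y hy => huv hi hy⟩

lemma tendsto_toNat_floor_mul_div {s₀ : ℝ} {S : Set ℝ} (hS : S ⊆ Ici 0) :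
    Tendsto (fun x : ℕ × ℝ => (⌊(x.1 : ℝ) * x.2⌋.toNat : ℝ) / x.1)
      (atTop ×ˢ 𝓝[S] s₀) (𝓝 s₀) := by
  have hs : Tendsto (fun x : ℕ × ℝ => x.2) (atTop ×ˢ 𝓝[S] s₀) (𝓝 s₀) :=
    tendsto_snd.mono_right nhdsWithin_le_nhds
  have hinv : Tendsto (fun x : ℕ × ℝ => ((x.1 : ℝ))⁻¹) (atTop ×ˢ 𝓝[S] s₀) (𝓝 0) :=
    tendsto_inv_atTop_nhds_zero_nat.comp tendsto_fst
  have hlow := hs.sub hinv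
  rw [sub_zero] at hlow
  have hmem : ∀ᶠ x : ℕ × ℝ in atTop ×ˢ 𝓝[S] s₀, 0 ≤ x.2 :=
    (tendsto_snd.eventually eventually_mem_nhdsWithin).mono fun x hx => hS hx
  have hpos : ∀ᶠ x : ℕ × ℝ in atTop ×ˢ 𝓝[S] s₀, 1 ≤ x.1 :=
    tendsto_fst.eventually (eventually_ge_atTop 1)
  refine tendsto_of_tendsto_of_tendsto_of_le_of_le' hlow hs ?_ ?_
  · filter_upwards [hmem, hpos] with x _ hx1
    have hN : (0 : ℝ) < x.1 := by exact_mod_cast hx1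
    rw [Int.floor_toNat, le_div_iff₀ hN, sub_mul, inv_mul_cancel₀ hN.ne']
    linarith [Nat.lt_floor_add_one ((x.1 : ℝ) * x.2)]
  · filter_upwards [hmem, hpos] with x hx0 hx1
    have hN : (0 : ℝ) < x.1 := by exact_mod_cast hx1
    rw [Int.floor_toNat, div_le_iff₀ hN, mul_comm x.2]
    exact Nat.floor_le (mul_nonneg hN.le hx0)

/-- Near a point `s₀`, the variance-ratio process eventually has a positive denominator and is
close to its limit. -/
lemma variance_ratio_eventually_near {K : ℝ → ℝ} {L : NNReal} (hK : LipschitzWith L K)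
    {h : ℕ → ℝ} (hpos : ∀ N, 0 < h N) {ζ : ℝ}
    (hconv : Tendsto (fun N : ℕ => (N : ℝ) / h N) atTop (𝓝 ζ))
    {κ : ℝ} (hκ : 0 < κ) {b : ℝ → ℝ} (hb : Continuous b)
    (hbpos : 0 < ∫ t in (0 : ℝ)..κ, (b t) ^ 2) {y : ℕ → ℕ → ℝ}
    (hy : ∀ ε > (0 : ℝ), ∃ N₀ : ℕ, ∀ N : ℕ, N₀ ≤ N → ∀ s ∈ Icc (0 : ℝ) 1,
      |(N : ℝ) ^ (-(1 / 2) : ℝ) * y N ⌊(N : ℝ) * s⌋.toNat - b s| < ε)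
    {s₀ : ℝ} (hs₀ : s₀ ∈ Icc κ 1) {ε : ℝ} (hε : 0 < ε) :
    ∀ᶠ x : ℕ × ℝ in atTop ×ˢ 𝓝[Icc κ 1] s₀,
      0 < ((⌊(x.1 : ℝ) * x.2⌋.toNat : ℝ) ^ 2)⁻¹ *
            ∑ j ∈ Finset.Icc 1 ⌊(x.1 : ℝ) * x.2⌋.toNat, (y x.1 j) ^ 2 ∧
      |(((⌊(x.1 : ℝ) * x.2⌋.toNat : ℝ) ^ 3)⁻¹ *
            (∑ i ∈ Finset.Icc 1 ⌊(x.1 : ℝ) * x.2⌋.toNat,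
              (∑ j ∈ Finset.Icc 1 i, y x.1 j) ^ 2 *
                (K (((i : ℝ) - (⌊(x.1 : ℝ) * x.2⌋.toNat : ℝ)) / h x.1) / h x.1))) /
          (((⌊(x.1 : ℝ) * x.2⌋.toNat : ℝ) ^ 2)⁻¹ *
            ∑ j ∈ Finset.Icc 1 ⌊(x.1 : ℝ) * x.2⌋.toNat, (y x.1 j) ^ 2) -
        ζ * x.2⁻¹ * (∫ r in (0 : ℝ)..x.2, K (ζ * (r - x.2)) * (∫ t in (0 : ℝ)..r, b t) ^ 2) /
          ∫ r in (0 : ℝ)..x.2, (b r) ^ 2| < ε := by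
  have hs₀pos : 0 < s₀ := hκ.trans_le hs₀.1
  set l : Filter (ℕ × ℝ) := atTop ×ˢ 𝓝[Icc κ 1] s₀
  set B : ℝ → ℝ := fun r => ∫ t in (0 : ℝ)..r, b t
  have hB : Continuous B :=
    intervalIntegral.continuous_primitive (fun _ _ => hb.intervalIntegrable _ _) 0
  set n : ℕ × ℝ → ℕ := fun x => ⌊(x.1 : ℝ) * x.2⌋.toNat with hn
  have hfst : Tendsto (Prod.fst : ℕ × ℝ → ℕ) l atTop := tendsto_fst
  have hsnd : Tendsto (Prod.snd : ℕ × ℝ → ℝ) l (𝓝 s₀) :=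
    tendsto_snd.mono_right nhdsWithin_le_nhds
  have hρ : Tendsto (fun x : ℕ × ℝ => (n x : ℝ) / x.1) l (𝓝 s₀) :=
    tendsto_toNat_floor_mul_div fun s hs => hκ.le.trans hs.1
  have hmem : ∀ᶠ x in l, x.2 ∈ Icc κ 1 := tendsto_snd.eventually eventually_mem_nhdsWithin
  have hnN : ∀ᶠ x in l, n x ≤ x.1 := by
    filter_upwards [hmem] with x hx
    rw [hn]
    simp only [Int.floor_toNat]
    refine Nat.floor_le_of_le ?_
    nlinarith [hx.2, (Nat.cast_nonneg x.1 : (0 : ℝ) ≤ x.1)]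
  have hratio : Tendsto (fun x : ℕ × ℝ => (x.1 : ℝ) / h x.1) l (𝓝 ζ) := hconv.comp hfst
  have hY : Tendsto (fun p : (ℕ × ℝ) × ℕ =>
      (p.1.1 : ℝ) ^ (-(1 / 2) : ℝ) * y p.1.1 p.2 - b (p.2 / p.1.1))
      (uniformIndexFilter l Prod.fst) (𝓝 0) := by
    rw [Metric.tendsto_nhds]
    intro δ hδ
    obtain ⟨N₀, hN₀⟩ := hy δ hδ
    rw [eventually_uniformIndexFilter]
    filter_upwards [hfst.eventually_ge_atTop N₀, hfst.eventually_ge_atTop 1] with x hx0 hx1 i hi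
    have hN : (0 : ℝ) < x.1 := by exact_mod_cast hx1
    have := hN₀ x.1 hx0 (i / x.1) ⟨by positivity, by
      rw [div_le_one hN]
      exact_mod_cast hi⟩
    rw [mul_div_cancel₀ _ hN.ne'] at this
    simpa [Real.dist_eq] using this
  have hYY := tendsto_mul_sub_mul_of_tendsto_sub hb hb hY hY
  have hDlim : Tendsto (fun x : ℕ × ℝ => (x.1 : ℝ)⁻¹ * ∑ i ∈ Finset.Icc 1 (n x),
      (x.1 : ℝ) ^ (-(1 / 2) : ℝ) * y x.1 i * ((x.1 : ℝ) ^ (-(1 / 2) : ℝ) * y x.1 i)) l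
      (𝓝 (∫ r in (0 : ℝ)..s₀, b r * b r)) := by
    have h1 := (tendsto_riemann_sum_sub_integral (g := fun r => b r * b r)
      (a := fun x i =>
        (x.1 : ℝ) ^ (-(1 / 2) : ℝ) * y x.1 i * ((x.1 : ℝ) ^ (-(1 / 2) : ℝ) * y x.1 i))
      hfst (hb.mul hb) hYY).comp (tendsto_prodMk_uniformIndexFilter hnN)
    have h2 : Continuous fun s => ∫ r in (0 : ℝ)..s, b r * b r :=
      intervalIntegral.continuous_primitive (fun _ _ => (hb.mul hb).intervalIntegrable _ _) 0
    simpa [Function.comp_def] using h1.add ((h2.tendsto s₀).comp hρ)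
  have hS := tendsto_riemann_sum_sub_integral
    (a := fun x i => (x.1 : ℝ) ^ (-(1 / 2) : ℝ) * y x.1 i) hfst hb hY
  have hSS := tendsto_mul_sub_mul_of_tendsto_sub hB hB hS hS
  have hkcont : Continuous fun r => K (ζ * (r - s₀)) := hK.continuous.comp (by fun_prop)
  have hKK : Tendsto (fun p : (ℕ × ℝ) × ℕ =>
      K (((p.2 : ℝ) - n p.1) / h p.1.1) - K (ζ * (p.2 / p.1.1 - s₀)))
      (uniformIndexFilter l Prod.fst) (𝓝 0) := by
    have e1 : Tendsto (fun p : (ℕ × ℝ) × ℕ => ((p.1.1 : ℝ) / h p.1.1 - ζ))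
        (uniformIndexFilter l Prod.fst) (𝓝 0) := by
      have := (hratio.sub_const ζ).comp (tendsto_fst_uniformIndexFilter (N := Prod.fst))
      rwa [sub_self] at this
    have e2 : Tendsto (fun p : (ℕ × ℝ) × ℕ =>
        (p.1.1 : ℝ) / h p.1.1 * ((n p.1 : ℝ) / p.1.1) - ζ * s₀)
        (uniformIndexFilter l Prod.fst) (𝓝 0) := by
      have := ((hratio.mul hρ).sub_const (ζ * s₀)).comp
        (tendsto_fst_uniformIndexFilter (N := Prod.fst))
      rwa [sub_self] at this
    have e3 := ((e1.abs.add e2.abs).const_mul (L : ℝ))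
    simp only [abs_zero, add_zero, mul_zero] at e3
    refine squeeze_zero_norm' ?_ e3
    filter_upwards [eventually_div_mem_Icc,
      (tendsto_fst_uniformIndexFilter (N := Prod.fst)).eventually
        (hfst.eventually_ge_atTop 1)] with p hp hp1
    have hN : (p.1.1 : ℝ) ≠ 0 := by
      have : p.1.1 ≠ 0 := by omega
      exact_mod_cast this
    rw [← dist_eq_norm]
    refine (hK.dist_le_mul _ _).trans (mul_le_mul_of_nonneg_left ?_ L.2)
    rw [Real.dist_eq]
    have e : ((p.2 : ℝ) - n p.1) / h p.1.1 - ζ * (p.2 / p.1.1 - s₀) =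
        ((p.1.1 : ℝ) / h p.1.1 - ζ) * (p.2 / p.1.1) -
          ((p.1.1 : ℝ) / h p.1.1 * ((n p.1 : ℝ) / p.1.1) - ζ * s₀) := by
      have := (hpos p.1.1).ne'
      field_simp
      ring
    rw [e]
    refine (abs_sub _ _).trans (add_le_add_left ?_ _)
    rw [abs_mul, abs_of_nonneg hp.1]
    exact mul_le_of_le_one_right (abs_nonneg _) hp.2
  have hAlim : Tendsto (fun x : ℕ × ℝ => (x.1 : ℝ)⁻¹ * ∑ i ∈ Finset.Icc 1 (n x),
      ((x.1 : ℝ)⁻¹ * ∑ j ∈ Finset.Icc 1 i, (x.1 : ℝ) ^ (-(1 / 2) : ℝ) * y x.1 j) *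
        ((x.1 : ℝ)⁻¹ * ∑ j ∈ Finset.Icc 1 i, (x.1 : ℝ) ^ (-(1 / 2) : ℝ) * y x.1 j) *
        K (((i : ℝ) - n x) / h x.1)) l
      (𝓝 (∫ r in (0 : ℝ)..s₀, B r * B r * K (ζ * (r - s₀)))) := by
    have hcont : Continuous fun r => B r * B r * K (ζ * (r - s₀)) := (hB.mul hB).mul hkcont
    have h1 := (tendsto_riemann_sum_sub_integral (g := fun r => B r * B r * K (ζ * (r - s₀)))
      (a := fun x i =>
        ((x.1 : ℝ)⁻¹ * ∑ j ∈ Finset.Icc 1 i, (x.1 : ℝ) ^ (-(1 / 2) : ℝ) * y x.1 j) *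
        ((x.1 : ℝ)⁻¹ * ∑ j ∈ Finset.Icc 1 i, (x.1 : ℝ) ^ (-(1 / 2) : ℝ) * y x.1 j) *
        K (((i : ℝ) - n x) / h x.1)) hfst hcont
      (tendsto_mul_sub_mul_of_tendsto_sub (g := fun r => B r * B r) (hB.mul hB) hkcont
        hSS hKK)).comp (tendsto_prodMk_uniformIndexFilter hnN)
    have h2 : Continuous fun s => ∫ r in (0 : ℝ)..s, B r * B r * K (ζ * (r - s₀)) :=
      intervalIntegral.continuous_primitive (fun _ _ => hcont.intervalIntegrable _ _) 0
    simpa [Function.comp_def] using h1.add ((h2.tendsto s₀).comp hρ)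
  have hDpos : 0 < ∫ r in (0 : ℝ)..s₀, b r * b r := by
    refine hbpos.trans_le ?_
    simp only [← pow_two]
    refine intervalIntegral.integral_mono_interval le_rfl hκ.le hs₀.1
      (Eventually.of_forall fun r => sq_nonneg (b r)) ((hb.pow 2).intervalIntegrable _ _)
  have hU := (((hρ.inv₀ hs₀pos.ne').mul hratio).mul hAlim).div hDlim hDpos.ne'
  have hI : Continuous fun s => ∫ r in (0 : ℝ)..s, (b r) ^ 2 :=
    intervalIntegral.continuous_primitive (fun _ _ => (hb.pow 2).intervalIntegrable _ _) 0
  have hJ : Continuous fun s => ∫ r in (0 : ℝ)..s, K (ζ * (r - s)) * (B r) ^ 2 := by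
    refine intervalIntegral.continuous_parametric_intervalIntegral_of_continuous
      (f := fun s r => K (ζ * (r - s)) * (B r) ^ 2) ?_ continuous_id
    exact (hK.continuous.comp (by fun_prop)).mul ((hB.comp continuous_snd).pow 2)
  have hV := ((((tendsto_const_nhds (x := ζ)).mul (hsnd.inv₀ hs₀pos.ne')).mul
    ((hJ.tendsto s₀).comp hsnd)).div ((hI.tendsto s₀).comp hsnd)
      (by simpa only [← pow_two] using hDpos.ne'))
  have hdiff := hU.sub hV
  have hlim : s₀⁻¹ * ζ * (∫ r in (0 : ℝ)..s₀, B r * B r * K (ζ * (r - s₀))) /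
      (∫ r in (0 : ℝ)..s₀, b r * b r) -
      ζ * s₀⁻¹ * (∫ r in (0 : ℝ)..s₀, K (ζ * (r - s₀)) * (B r) ^ 2) /
      (∫ r in (0 : ℝ)..s₀, (b r) ^ 2) = 0 := by
    simp only [← pow_two, mul_comm, sub_self]
  rw [hlim, Metric.tendsto_nhds] at hdiff
  filter_upwards [hdiff ε hε, hDlim.eventually_const_lt hDpos, hfst.eventually_ge_atTop 1,
    hρ.eventually_const_lt hs₀pos] with x hx hDx hx1 hnx
  have hN : (0 : ℝ) < x.1 := by exact_mod_cast hx1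
  have hnpos : (0 : ℝ) < n x := by
    by_contra hcon
    have : (n x : ℝ) = 0 := le_antisymm (not_lt.1 hcon) (Nat.cast_nonneg _)
    rw [this, zero_div] at hnx
    exact lt_irrefl _ hnx
  have hc : (x.1 : ℝ) ^ (-(1 / 2) : ℝ) * (x.1 : ℝ) ^ (-(1 / 2) : ℝ) = (x.1 : ℝ)⁻¹ := by
    rw [← Real.rpow_add hN, ← Real.rpow_neg_one]
    norm_num
  have hDeq : (x.1 : ℝ)⁻¹ * ∑ i ∈ Finset.Icc 1 (n x),
      (x.1 : ℝ) ^ (-(1 / 2) : ℝ) * y x.1 i * ((x.1 : ℝ) ^ (-(1 / 2) : ℝ) * y x.1 i) =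
      ((x.1 : ℝ)⁻¹) ^ 2 * ∑ j ∈ Finset.Icc 1 (n x), (y x.1 j) ^ 2 := by
    rw [pow_two, mul_assoc]
    congr 1
    rw [Finset.mul_sum]
    refine Finset.sum_congr rfl fun i _ => ?_
    rw [mul_mul_mul_comm, hc, pow_two]
  have hAeq : (x.1 : ℝ)⁻¹ * ∑ i ∈ Finset.Icc 1 (n x),
      ((x.1 : ℝ)⁻¹ * ∑ j ∈ Finset.Icc 1 i, (x.1 : ℝ) ^ (-(1 / 2) : ℝ) * y x.1 j) *
        ((x.1 : ℝ)⁻¹ * ∑ j ∈ Finset.Icc 1 i, (x.1 : ℝ) ^ (-(1 / 2) : ℝ) * y x.1 j) *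
        K (((i : ℝ) - n x) / h x.1) =
      ((x.1 : ℝ)⁻¹) ^ 4 * h x.1 * ∑ i ∈ Finset.Icc 1 (n x), (∑ j ∈ Finset.Icc 1 i, y x.1 j) ^ 2 *
        (K (((i : ℝ) - n x) / h x.1) / h x.1) := by
    rw [Finset.mul_sum, Finset.mul_sum]
    refine Finset.sum_congr rfl fun i _ => ?_
    rw [← Finset.mul_sum]
    have hh := (hpos x.1).ne'
    generalize (x.1 : ℝ) ^ (-(1 / 2) : ℝ) = c at hc
    generalize K (((i : ℝ) - n x) / h x.1) = k
    rw [show (x.1 : ℝ)⁻¹ ^ 4 = (x.1 : ℝ)⁻¹ ^ 3 * (c * c) by rw [hc]; ring]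
    field_simp
  rw [hDeq] at hDx
  have hQ : 0 < ∑ j ∈ Finset.Icc 1 (n x), (y x.1 j) ^ 2 :=
    pos_of_mul_pos_right hDx (by positivity)
  refine ⟨mul_pos (by positivity) hQ, ?_⟩
  rw [Real.dist_eq, sub_zero] at hx
  refine lt_of_eq_of_lt (congrArg abs (congrArg₂ _ ?_ rfl)) hx
  change _ = ((n x : ℝ) / x.1)⁻¹ * ((x.1 : ℝ) / h x.1) * _ / _
  beta_reduce
  rw [hDeq, hAeq]
  have hh := (hpos x.1).ne'
  have hQ' := hQ.ne'
  have hN' := hN.ne'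
  have hn' := hnpos.ne'
  change ((n x : ℝ) ^ 3)⁻¹ * _ /
    (((n x : ℝ) ^ 2)⁻¹ * ∑ j ∈ Finset.Icc 1 (n x), (y x.1 j) ^ 2) = _
  generalize ∑ i ∈ Finset.Icc 1 (n x), (∑ j ∈ Finset.Icc 1 i, y x.1 j) ^ 2 *
        (K (((i : ℝ) - n x) / h x.1) / h x.1) = T
  field_simp


/-- Deterministic pathwise version of Theorem 3.1. With `K` Lipschitz
and bounded, `N/h_N → ζ ∈ [1,∞)`, `κ ∈ (0,1)`, `b` continuous with `∫_0^κ b² > 0`,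
and `sup_{s∈[0,1]} |N^{−1/2} y_{N,⌊Ns⌋} − b(s)| → 0`, the variance-ratio process
`U_N(s) = [⌊Ns⌋^{−3} ∑_{i=1}^{⌊Ns⌋} (∑_{j=1}^i y_{N,j})² K_{h_N}(i − ⌊Ns⌋)] /
[⌊Ns⌋^{−2} ∑_{j=1}^{⌊Ns⌋} y_{N,j}²]` has eventually positive denominator on `[κ,1]`
and converges uniformly on `[κ,1]` to
`𝒰(s) = ζ s^{−1} ∫_0^s K(ζ(r−s)) (∫_0^r b)² dr / ∫_0^s b(r)² dr`. -/
theorem variance_ratio_process_uniform_convergence_I1 (K : ℝ → ℝ) (L : NNReal)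
    (hK : LipschitzWith L K) (CK : ℝ) (hKbd : ∀ x, |K x| ≤ CK)
    (h : ℕ → ℝ) (hpos : ∀ N, 0 < h N) (ζ : ℝ) (hζ : 1 ≤ ζ)
    (hconv : Filter.Tendsto (fun N : ℕ => (N : ℝ) / h N) Filter.atTop (nhds ζ))
    (κ : ℝ) (hκ : κ ∈ Set.Ioo (0 : ℝ) 1)
    (b : ℝ → ℝ) (hb : ContinuousOn b (Set.Icc (0 : ℝ) 1))
    (hbpos : 0 < ∫ t in (0 : ℝ)..κ, (b t) ^ 2)
    (y : ℕ → ℕ → ℝ) (hy0 : ∀ N, y N 0 = 0)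
    (hy : ∀ ε > (0 : ℝ), ∃ N₀ : ℕ, ∀ N : ℕ, N₀ ≤ N → ∀ s ∈ Set.Icc (0 : ℝ) 1,
      |(N : ℝ) ^ (-(1 / 2) : ℝ) * y N ⌊(N : ℝ) * s⌋.toNat - b s| < ε) :
    (∃ N₁ : ℕ, ∀ N : ℕ, N₁ ≤ N → ∀ s ∈ Set.Icc κ 1,
      0 < ((⌊(N : ℝ) * s⌋.toNat : ℝ) ^ 2)⁻¹ *
            ∑ j ∈ Finset.Icc 1 ⌊(N : ℝ) * s⌋.toNat, (y N j) ^ 2) ∧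
    (∀ ε > (0 : ℝ), ∃ N₀ : ℕ, ∀ N : ℕ, N₀ ≤ N → ∀ s ∈ Set.Icc κ 1,
      |(((⌊(N : ℝ) * s⌋.toNat : ℝ) ^ 3)⁻¹ *
            (∑ i ∈ Finset.Icc 1 ⌊(N : ℝ) * s⌋.toNat,
              (∑ j ∈ Finset.Icc 1 i, y N j) ^ 2 *
                (K (((i : ℝ) - (⌊(N : ℝ) * s⌋.toNat : ℝ)) / h N) / h N))) /
          (((⌊(N : ℝ) * s⌋.toNat : ℝ) ^ 2)⁻¹ *
            ∑ j ∈ Finset.Icc 1 ⌊(N : ℝ) * s⌋.toNat, (y N j) ^ 2) -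
        ζ * s⁻¹ * (∫ r in (0 : ℝ)..s, K (ζ * (r - s)) * (∫ t in (0 : ℝ)..r, b t) ^ 2) /
          ∫ r in (0 : ℝ)..s, (b r) ^ 2| < ε) := by
  have hcont : Continuous (IccExtend (zero_le_one' ℝ) ((Icc (0 : ℝ) 1).domRestrict b)) :=
    (continuousOn_iff_continuous_domRestrict.1 hb).Icc_extend'
  set b' := IccExtend (zero_le_one' ℝ) ((Icc (0 : ℝ) 1).domRestrict b) with hb'
  have hbb' : ∀ s ∈ Icc (0 : ℝ) 1, b s = b' s := fun s hs => by
    rw [hb', IccExtend_of_mem _ _ hs, domRestrict_apply]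
  have hsub : ∀ s ∈ Icc (0 : ℝ) 1, ∀ r ∈ uIcc 0 s, r ∈ Icc (0 : ℝ) 1 := fun s hs r hr => by
    rw [uIcc_of_le hs.1] at hr
    exact ⟨hr.1, hr.2.trans hs.2⟩
  have hint1 : ∀ s ∈ Icc (0 : ℝ) 1, ∫ t in (0 : ℝ)..s, b t = ∫ t in (0 : ℝ)..s, b' t :=
    fun s hs => intervalIntegral.integral_congr fun r hr => hbb' r (hsub s hs r hr)
  have hint2 : ∀ s ∈ Icc (0 : ℝ) 1,
      ∫ t in (0 : ℝ)..s, (b t) ^ 2 = ∫ t in (0 : ℝ)..s, (b' t) ^ 2 :=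
    fun s hs => intervalIntegral.integral_congr fun r hr =>
      congrArg (· ^ 2) (hbb' r (hsub s hs r hr))
  have hint3 : ∀ s ∈ Icc (0 : ℝ) 1,
      ∫ r in (0 : ℝ)..s, K (ζ * (r - s)) * (∫ t in (0 : ℝ)..r, b t) ^ 2 =
      ∫ r in (0 : ℝ)..s, K (ζ * (r - s)) * (∫ t in (0 : ℝ)..r, b' t) ^ 2 :=
    fun s hs => intervalIntegral.integral_congr fun r hr =>
      congrArg (fun z => K (ζ * (r - s)) * z ^ 2) (hint1 r (hsub s hs r hr))
  rw [hint2 κ ⟨hκ.1.le, hκ.2.le⟩] at hbpos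
  have hy' : ∀ ε > (0 : ℝ), ∃ N₀ : ℕ, ∀ N : ℕ, N₀ ≤ N → ∀ s ∈ Icc (0 : ℝ) 1,
      |(N : ℝ) ^ (-(1 / 2) : ℝ) * y N ⌊(N : ℝ) * s⌋.toNat - b' s| < ε := by
    intro ε hε
    obtain ⟨N₀, hN₀⟩ := hy ε hε
    exact ⟨N₀, fun N hN s hs => hbb' s hs ▸ hN₀ N hN s hs⟩
  have hmain := fun (ε : ℝ) (hε : 0 < ε) => isCompact_Icc.eventually_forall_mem
    fun s₀ hs₀ => variance_ratio_eventually_near hK hpos hconv hκ.1 hcont hbpos hy' hs₀ hε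
  constructor
  · obtain ⟨N₁, hN₁⟩ := eventually_atTop.1 (hmain 1 one_pos)
    exact ⟨N₁, fun N hN s hs => (hN₁ N hN s hs).1⟩
  · intro ε hε
    obtain ⟨N₀, hN₀⟩ := eventually_atTop.1 (hmain ε hε)
    refine ⟨N₀, fun N hN s hs => ?_⟩
    have hs01 : s ∈ Icc (0 : ℝ) 1 := ⟨hκ.1.le.trans hs.1, hs.2⟩
    rw [hint2 s hs01, hint3 s hs01]
    exact (hN₀ N hN s hs).2
end

section
/- Let K : ℝ → ℝ be Lipschitz continuous and bounded, let (h_N) be a sequence of positive reals with N/h_N → ζ as N → ∞ for some ζ ∈ [1,∞), and let κ ∈ (0,1). Let b : [0,1] → ℝ be continuous, and let (y_{N,i}), 1 ≤ i ≤ N, be a triangular array of reals such that sup_{s∈[0,1]} | N^{−1/2} ∑_{j=1}^{⌊Ns⌋} y_{N,j} − b(s) | → 0 as N → ∞. Then sup_{s∈[κ,1]} | ⌊Ns⌋^{−1} ∑_{i=1}^{⌊Ns⌋} ( ∑_{j=1}^{i} y_{N,j} )^2 K_{h_N}(i − ⌊Ns⌋) − s^{−1} ζ ∫_0^s b(r)^2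 K(ζ(r − s)) dr | → 0 as N → ∞. -/
open Set Filter Topology MeasureTheory

/-- Error bound for right-endpoint Riemann sums of mesh `δ` whose values need only be
uniformly close to the integrand. -/
theorem abs_mul_sum_sub_integral_le (g : ℝ → ℝ) (F : ℕ → ℝ) (δ c : ℝ) (hδ : 0 ≤ δ) (m : ℕ)
    (hg : ContinuousOn g (Icc 0 (m * δ)))
    (hF : ∀ i < m, ∀ r ∈ Icc (i * δ) ((i + 1 : ℕ) * δ), |F (i + 1) - g r| ≤ c) :
    |δ * ∑ i ∈ Finset.Icc 1 m, F i - ∫ r in (0 : ℝ)..(m * δ), g r| ≤ m * δ * c := by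
  induction m with
  | zero => simp
  | succ m ih =>
    have hm : (m : ℝ) * δ ≤ (m + 1 : ℕ) * δ := by gcongr; simp
    have hm0 : 0 ≤ (m : ℝ) * δ := by positivity
    have hstep : ((m + 1 : ℕ) : ℝ) * δ - m * δ = δ := by push_cast; ring
    have ih' := ih (hg.mono (Icc_subset_Icc_right hm)) fun i hi => hF i (by omega)
    have hi1 : IntervalIntegrable g volume 0 (m * δ) :=
      (hg.mono (by rw [uIcc_of_le hm0]; exact Icc_subset_Icc_right hm)).intervalIntegrable
    have hi2 : IntervalIntegrable g volume (m * δ) ((m + 1 : ℕ) * δ) :=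
      (hg.mono (by rw [uIcc_of_le hm]; exact Icc_subset_Icc_left hm0)).intervalIntegrable
    have hlast : |δ * F (m + 1) - ∫ r in (m * δ)..((m + 1 : ℕ) * δ), g r| ≤ δ * c := by
      have hconst : δ * F (m + 1) = ∫ _ in (m * δ)..((m + 1 : ℕ) * δ), F (m + 1) := by
        rw [intervalIntegral.integral_const, hstep, smul_eq_mul]
      rw [hconst, ← intervalIntegral.integral_sub (by simp) hi2, mul_comm δ c, ← Real.norm_eq_abs]
      refine (intervalIntegral.norm_integral_le_of_norm_le_const (C := c) fun r hr => ?_).trans_eq ?_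
      · rw [uIoc_of_le hm] at hr
        exact hF m (by omega) r (Ioc_subset_Icc_self hr)
      · rw [hstep, abs_of_nonneg hδ]
    rw [Finset.sum_Icc_succ_top (by omega),
      ← intervalIntegral.integral_add_adjacent_intervals hi1 hi2]
    have hsplit := abs_add_le (δ * ∑ i ∈ Finset.Icc 1 m, F i - ∫ r in (0 : ℝ)..(m * δ), g r)
      (δ * F (m + 1) - ∫ r in (m * δ)..((m + 1 : ℕ) * δ), g r)
    calc _ = _ := by congr 1; ring
      _ ≤ _ := hsplit
      _ ≤ m * δ * c + δ * c := add_le_add ih' hlast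
      _ = _ := by push_cast; ring

theorem abs_sq_mul_kernel_sub_le {K : ℝ → ℝ} {L : NNReal} (hK : LipschitzWith L K) {CK : ℝ}
    (hKbd : ∀ x, |K x| ≤ CK) {M η ζ Z f β u v : ℝ}
    (hζ : 0 ≤ ζ) (hZ : |Z - ζ| ≤ η) (hf : |f| ≤ M + 1) (hβ : |β| ≤ M) (hfβ : |f - β| ≤ 2 * η)
    (hu : |u| ≤ 1) (huv : |u - v| ≤ 2 * η) :
    |f ^ 2 * K (Z * u) - β ^ 2 * K (ζ * v)| ≤
      ((M + 1) ^ 2 * (L * (1 + 2 * ζ)) + 2 * (2 * M + 1) * CK) * η := by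
  have hη : 0 ≤ η := (abs_nonneg _).trans hZ
  have hM : 0 ≤ M := (abs_nonneg _).trans hβ
  have hKd : |K (Z * u) - K (ζ * v)| ≤ L * (1 + 2 * ζ) * η := by
    have h1 := hK.dist_le_mul (Z * u) (ζ * v)
    rw [Real.dist_eq, Real.dist_eq] at h1
    have h2 : |Z * u - ζ * v| ≤ (1 + 2 * ζ) * η := by
      calc |Z * u - ζ * v| = |(Z - ζ) * u + ζ * (u - v)| := by congr 1; ring
        _ ≤ |Z - ζ| * |u| + ζ * |u - v| := by
          refine (abs_add_le _ _).trans_eq ?_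
          rw [abs_mul, abs_mul, abs_of_nonneg hζ]
        _ ≤ η * 1 + ζ * (2 * η) := by gcongr
        _ = _ := by ring
    calc _ ≤ _ := h1
      _ ≤ L * ((1 + 2 * ζ) * η) := by gcongr
      _ = _ := by ring
  have hsq : |f ^ 2 - β ^ 2| ≤ 2 * (2 * M + 1) * η := by
    calc |f ^ 2 - β ^ 2| = |f - β| * |f + β| := by rw [← abs_mul]; congr 1; ring
      _ ≤ 2 * η * (M + 1 + M) := by
        gcongr
        exact (abs_add_le _ _).trans (add_le_add hf hβ)
      _ = _ := by ring
  calc _ = |f ^ 2 * (K (Z * u) - K (ζ * v)) + (f ^ 2 - β ^ 2) * K (ζ * v)| := by congr 1; ring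
    _ ≤ |f| ^ 2 * |K (Z * u) - K (ζ * v)| + |f ^ 2 - β ^ 2| * |K (ζ * v)| := by
      refine (abs_add_le _ _).trans_eq ?_
      rw [abs_mul, abs_mul, abs_pow]
    _ ≤ (M + 1) ^ 2 * (L * (1 + 2 * ζ) * η) + 2 * (2 * M + 1) * η * CK := by
      gcongr
      exact hKbd _
    _ = _ := by ring

/-- Quantitative comparison of the normalised kernel-weighted sum of squares with its limiting
integral. -/
theorem abs_kernel_sum_sub_integral_le {K : ℝ → ℝ} {L : NNReal} (hK : LipschitzWith L K) {CK : ℝ}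
    (hKbd : ∀ x, |K x| ≤ CK) {ζ Z η M : ℝ} (hη1 : η ≤ 1) (hζ : 0 ≤ ζ) (hZ : |Z - ζ| ≤ η)
    {b : ℝ → ℝ} (hb : ContinuousOn b (Icc 0 1)) (hbM : ∀ x ∈ Icc (0 : ℝ) 1, |b x| ≤ M)
    {N : ℕ} (hN : 0 < N) (hNη : (N : ℝ)⁻¹ ≤ η)
    (hmod : ∀ x ∈ Icc (0 : ℝ) 1, ∀ y ∈ Icc (0 : ℝ) 1, |x - y| ≤ (N : ℝ)⁻¹ → |b x - b y| ≤ η)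
    {f : ℕ → ℝ} (hf : ∀ i ≤ N, |f i - b (i * (N : ℝ)⁻¹)| ≤ η)
    {s : ℝ} (hs : s ∈ Icc (0 : ℝ) 1) :
    |(N : ℝ)⁻¹ * ∑ i ∈ Finset.Icc 1 ⌊(N : ℝ) * s⌋₊,
        f i ^ 2 * K (Z * (i * (N : ℝ)⁻¹ - ⌊(N : ℝ) * s⌋₊ * (N : ℝ)⁻¹)) -
      ∫ r in (0 : ℝ)..s, b r ^ 2 * K (ζ * (r - s))| ≤
      ((M + 1) ^ 2 * (L * (1 + 2 * ζ)) + 2 * (2 * M + 1) * CK + M ^ 2 * CK) * η := by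
  obtain ⟨hs0, hs1⟩ := hs
  have hη : 0 ≤ η := (abs_nonneg _).trans hZ
  have hCK : 0 ≤ CK := (abs_nonneg _).trans (hKbd 0)
  have hM : 0 ≤ M := (abs_nonneg _).trans (hbM 0 (by simp))
  have hN' : (0 : ℝ) < N := by exact_mod_cast hN
  set n := ⌊(N : ℝ) * s⌋₊ with hn
  set δ := (N : ℝ)⁻¹ with hδ
  have hδ0 : 0 < δ := inv_pos.2 hN'
  have hNδ : N * δ = 1 := mul_inv_cancel₀ hN'.ne'
  have hns : n * δ ≤ s := by
    rw [hδ, ← div_eq_mul_inv, div_le_iff₀ hN', mul_comm]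
    exact Nat.floor_le (by positivity)
  have hsn : s - n * δ ≤ δ := by
    have h1 : (N : ℝ) * s ≤ n + 1 := (Nat.lt_floor_add_one _).le
    have h2 := mul_le_mul_of_nonneg_right h1 hδ0.le
    linear_combination h2 - s * hNδ
  have hnN : n ≤ N := Nat.floor_le_of_le (by nlinarith)
  have hn0 : 0 ≤ n * δ := by positivity
  have hcont : ContinuousOn (fun r => b r ^ 2 * K (ζ * (r - s))) (Icc 0 1) :=
    (hb.pow 2).mul (hK.continuous.comp (by fun_prop)).continuousOn
  have hi1 : IntervalIntegrable (fun r => b r ^ 2 * K (ζ * (r - s))) volume 0 (n * δ) :=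
    (hcont.mono (by
      rw [uIcc_of_le hn0]
      exact Icc_subset_Icc_right (hns.trans hs1))).intervalIntegrable
  have hi2 : IntervalIntegrable (fun r => b r ^ 2 * K (ζ * (r - s))) volume (n * δ) s :=
    (hcont.mono (by rw [uIcc_of_le hns]; exact Icc_subset_Icc hn0 hs1)).intervalIntegrable
  set c := ((M + 1) ^ 2 * (L * (1 + 2 * ζ)) + 2 * (2 * M + 1) * CK) * η with hc
  have hc0 : 0 ≤ c := by positivity
  have hsum := abs_mul_sum_sub_integral_le (fun r => b r ^ 2 * K (ζ * (r - s)))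
    (fun i => f i ^ 2 * K (Z * (i * δ - n * δ))) δ c hδ0.le n
    (hcont.mono (Icc_subset_Icc_right (hns.trans hs1))) (by
      intro i hi r hr
      have hle : ((i + 1 : ℕ) : ℝ) * δ ≤ n * δ := by
        gcongr; omega
      have hi0 : 0 ≤ (i : ℝ) * δ := by positivity
      have hgap : ((i + 1 : ℕ) : ℝ) * δ - i * δ = δ := by push_cast; ring
      have hr' : r ∈ Icc (0 : ℝ) 1 := ⟨hi0.trans hr.1, by linarith [hr.2]⟩
      have hx : ((i + 1 : ℕ) : ℝ) * δ ∈ Icc (0 : ℝ) 1 := ⟨by positivity, by linarith⟩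
      have hfi := hf (i + 1) (by omega)
      have hbr := hmod _ hx r hr' (by rw [abs_le]; constructor <;> linarith [hr.1, hr.2])
      refine abs_sq_mul_kernel_sub_le hK hKbd hζ hZ ?_ (hbM r hr') ?_ ?_ ?_
      · have := hbM _ hx
        rw [abs_le] at *
        constructor <;> linarith
      · rw [abs_le] at *
        constructor <;> linarith
      · rw [abs_le]
        constructor <;> linarith [hx.1]
      · rw [abs_le]
        constructor <;> linarith [hr.1, hr.2])
  have htail : |∫ r in (n * δ)..s, b r ^ 2 * K (ζ * (r - s))| ≤ M ^ 2 * CK * η := by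
    rw [← Real.norm_eq_abs]
    refine (intervalIntegral.norm_integral_le_of_norm_le_const (C := M ^ 2 * CK)
      fun r hr => ?_).trans ?_
    · rw [uIoc_of_le hns] at hr
      rw [Real.norm_eq_abs, abs_mul, abs_pow]
      gcongr
      · exact hbM r ⟨hn0.trans hr.1.le, hr.2.trans hs1⟩
      · exact hKbd _
    · rw [abs_of_nonneg (by linarith)]
      gcongr
      linarith
  rw [← intervalIntegral.integral_add_adjacent_intervals hi1 hi2]
  have hnc : n * δ * c ≤ c := mul_le_of_le_one_left hc0 (hns.trans hs1)
  rw [abs_le] at *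
  constructor <;> linarith

theorem abs_div_sub_div_le {κ s t Z ζ η : ℝ} (hκ : 0 < κ) (hs : s ∈ Icc κ 1) (ht : κ / 2 ≤ t)
    (hst : |s - t| ≤ η) (hζ : 0 ≤ ζ) (hZ : |Z - ζ| ≤ η) :
    |Z / t - ζ / s| ≤ 2 * (1 + ζ) / κ ^ 2 * η := by
  have hs0 : 0 < s := hκ.trans_le hs.1
  have ht0 : 0 < t := (half_pos hκ).trans_le ht
  have hη : 0 ≤ η := (abs_nonneg _).trans hZ
  have hnum : |Z * s - t * ζ| ≤ (1 + ζ) * η := by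
    calc |Z * s - t * ζ| = |(Z - ζ) * s + ζ * (s - t)| := by congr 1; ring
      _ ≤ |Z - ζ| * s + ζ * |s - t| := by
        refine (abs_add_le _ _).trans_eq ?_
        rw [abs_mul, abs_mul, abs_of_nonneg hζ, abs_of_pos hs0]
      _ ≤ η * 1 + ζ * η := by gcongr; exact hs.2
      _ = _ := by ring
  rw [div_sub_div _ _ ht0.ne' hs0.ne', abs_div, abs_of_pos (mul_pos ht0 hs0)]
  calc _ ≤ (1 + ζ) * η / (κ / 2 * κ) := by gcongr; exact hs.1
    _ = _ := by field_simp


/-- `K` Lipschitz and bounded, `N/h_N → ζ ∈ [1,∞)`, `κ ∈ (0,1)`, `b`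
continuous on `[0,1]`, and `(y_{N,i})` a triangular array with
`sup_{s∈[0,1]} |N^{−1/2} ∑_{j=1}^{⌊Ns⌋} y_{N,j} − b(s)| → 0`. Then
`sup_{s∈[κ,1]} |⌊Ns⌋^{−1} ∑_{i=1}^{⌊Ns⌋} (∑_{j=1}^i y_{N,j})² K_{h_N}(i − ⌊Ns⌋)
  − s^{−1} ζ ∫_0^s b(r)² K(ζ(r − s)) dr| → 0`, where `K_h(x) = K(x/h)/h`. -/
theorem variance_ratio_numerator_I0 (K : ℝ → ℝ) (L : NNReal)
    (hK : LipschitzWith L K) (CK : ℝ) (hKbd : ∀ x, |K x| ≤ CK)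
    (h : ℕ → ℝ) (hpos : ∀ N, 0 < h N) (ζ : ℝ) (hζ : 1 ≤ ζ)
    (hconv : Filter.Tendsto (fun N : ℕ => (N : ℝ) / h N) Filter.atTop (nhds ζ))
    (κ : ℝ) (hκ : κ ∈ Set.Ioo (0 : ℝ) 1)
    (b : ℝ → ℝ) (hb : ContinuousOn b (Set.Icc (0 : ℝ) 1))
    (y : ℕ → ℕ → ℝ)
    (hy : ∀ ε > (0 : ℝ), ∃ N₀ : ℕ, ∀ N : ℕ, N₀ ≤ N → ∀ s ∈ Set.Icc (0 : ℝ) 1,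
      |(N : ℝ) ^ (-(1 / 2) : ℝ) * ∑ j ∈ Finset.Icc 1 ⌊(N : ℝ) * s⌋.toNat, y N j - b s| < ε) :
    ∀ ε > (0 : ℝ), ∃ N₀ : ℕ, ∀ N : ℕ, N₀ ≤ N → ∀ s ∈ Set.Icc κ 1,
      |((⌊(N : ℝ) * s⌋.toNat : ℝ))⁻¹ *
          (∑ i ∈ Finset.Icc 1 ⌊(N : ℝ) * s⌋.toNat,
            (∑ j ∈ Finset.Icc 1 i, y N j) ^ 2 *
              (K (((i : ℝ) - (⌊(N : ℝ) * s⌋.toNat : ℝ)) / h N) / h N)) -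
        s⁻¹ * ζ * ∫ r in (0 : ℝ)..s, (b r) ^ 2 * K (ζ * (r - s))| < ε := by
  intro ε hε
  obtain ⟨hκ0, hκ1⟩ := hκ
  have hζ0 : 0 ≤ ζ := by linarith
  have hCK : 0 ≤ CK := (abs_nonneg _).trans (hKbd 0)
  obtain ⟨M, hM⟩ := isCompact_Icc.exists_bound_of_continuousOn hb
  have hM0 : 0 ≤ M := (norm_nonneg _).trans (hM 0 (by simp))
  set C₁ := (M + 1) ^ 2 * (L * (1 + 2 * ζ)) + 2 * (2 * M + 1) * CK + M ^ 2 * CK with hC₁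
  set C₂ := 2 * (1 + ζ) / κ ^ 2 with hC₂
  set C := (ζ + 1) / (κ / 2) * C₁ + C₂ * (M ^ 2 * CK) with hC
  have hC0 : 0 ≤ C := by positivity
  obtain ⟨η, hη0, hη1, hηκ, hηε⟩ : ∃ η : ℝ, 0 < η ∧ η ≤ 1 ∧ η ≤ κ / 2 ∧ C * η < ε := by
    refine ⟨min (min 1 (κ / 2)) (ε / (C + 1)), by positivity,
      (min_le_left _ _).trans (min_le_left _ _), (min_le_left _ _).trans (min_le_right _ _), ?_⟩
    calc _ ≤ C * (ε / (C + 1)) := by gcongr; exact min_le_right _ _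
      _ < ε := by
        rw [← mul_div_assoc, div_lt_iff₀ (by positivity)]
        nlinarith
  obtain ⟨δ, hδ0, hδ⟩ := Metric.uniformContinuousOn_iff.1
    (isCompact_Icc.uniformContinuousOn_of_continuous hb) η hη0
  obtain ⟨N₁, hN₁⟩ := hy η hη0
  have hinv : Tendsto (fun N : ℕ => (N : ℝ)⁻¹) atTop (𝓝 0) := tendsto_inv_atTop_nhds_zero_nat
  obtain ⟨N₀, hN₀⟩ := eventually_atTop.1 ((eventually_ge_atTop N₁).and
    ((eventually_gt_atTop 0).and ((hinv.eventually_lt_const hη0).and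
      ((hinv.eventually_lt_const hδ0).and (Metric.tendsto_nhds.1 hconv η hη0)))))
  refine ⟨N₀, fun N hN s hs => ?_⟩
  obtain ⟨hNN₁, hNpos, hNη, hNδ, hZ⟩ := hN₀ N hN
  have hN' : (0 : ℝ) < N := by exact_mod_cast hNpos
  rw [Real.dist_eq] at hZ
  set Z := (N : ℝ) / h N with hZdef
  have hs0 : 0 < s := hκ0.trans_le hs.1
  simp only [Int.floor_toNat] at hN₁ ⊢
  have hsum := abs_kernel_sum_sub_integral_le hK hKbd hη1 hζ0 hZ.le hb hM hNpos hNη.le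
    (fun x hx y hy hxy => (hδ x hx y hy (hxy.trans_lt hNδ)).le)
    (f := fun i => (N : ℝ) ^ (-(1 / 2) : ℝ) * ∑ j ∈ Finset.Icc 1 i, y N j) (by
      intro i hi
      have hmem : (i : ℝ) * (N : ℝ)⁻¹ ∈ Icc (0 : ℝ) 1 := by
        refine ⟨by positivity, ?_⟩
        rw [← div_eq_mul_inv, div_le_one hN']
        exact_mod_cast hi
      have := hN₁ N hNN₁ _ hmem
      rw [show (N : ℝ) * (i * (N : ℝ)⁻¹) = i by field_simp, Nat.floor_natCast] at this
      exact this.le) ⟨hs0.le, hs.2⟩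
  set n := ⌊(N : ℝ) * s⌋₊ with hn
  set t := (n : ℝ) * (N : ℝ)⁻¹ with ht
  set I := ∫ r in (0 : ℝ)..s, b r ^ 2 * K (ζ * (r - s)) with hI
  set G := (N : ℝ)⁻¹ * ∑ i ∈ Finset.Icc 1 n,
    ((N : ℝ) ^ (-(1 / 2) : ℝ) * ∑ j ∈ Finset.Icc 1 i, y N j) ^ 2 *
      K (Z * (i * (N : ℝ)⁻¹ - t)) with hG
  have hts : t ≤ s := by
    rw [ht, ← div_eq_mul_inv, div_le_iff₀ hN', mul_comm]
    exact Nat.floor_le (by positivity)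
  have hst : s - t ≤ η := by
    have h1 : (N : ℝ) * s ≤ n + 1 := (Nat.lt_floor_add_one _).le
    have h2 := mul_le_mul_of_nonneg_right h1 (inv_nonneg.2 hN'.le)
    linear_combination h2 - s * mul_inv_cancel₀ hN'.ne' + hNη.le
  have htκ : κ / 2 ≤ t := by linarith [hs.1]
  have ht0 : 0 < t := by linarith
  have hcoef := abs_div_sub_div_le hκ0 hs htκ
    (by rw [abs_of_nonneg (by linarith)]; exact hst) hζ0 hZ.le
  have hIbd : |I| ≤ M ^ 2 * CK := by
    rw [← Real.norm_eq_abs]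
    refine (intervalIntegral.norm_integral_le_of_norm_le_const (C := M ^ 2 * CK)
      fun r hr => ?_).trans ?_
    · rw [uIoc_of_le hs0.le] at hr
      rw [Real.norm_eq_abs, abs_mul, abs_pow]
      gcongr
      · exact hM r ⟨hr.1.le, hr.2.trans hs.2⟩
      · exact hKbd _
    · rw [sub_zero, abs_of_pos hs0]
      exact mul_le_of_le_one_right (by positivity) hs.2
  have hZt : |Z / t| ≤ (ζ + 1) / (κ / 2) := by
    rw [abs_div, abs_of_pos ht0]
    gcongr
    rw [abs_lt] at hZ
    rw [abs_le]
    constructor <;> linarith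
  have hLHS : (n : ℝ)⁻¹ * (∑ i ∈ Finset.Icc 1 n, (∑ j ∈ Finset.Icc 1 i, y N j) ^ 2 *
      (K (((i : ℝ) - n) / h N) / h N)) = Z / t * G := by
    rw [hG, Finset.mul_sum, Finset.mul_sum, Finset.mul_sum]
    refine Finset.sum_congr rfl fun i _ => ?_
    have harg : Z * (i * (N : ℝ)⁻¹ - t) = ((i : ℝ) - n) / h N := by
      rw [ht, hZdef]; field_simp
    have hpow : ((N : ℝ) ^ (-(1 / 2) : ℝ)) ^ 2 = (N : ℝ)⁻¹ := by
      rw [← Real.rpow_natCast, ← Real.rpow_mul hN'.le, ← Real.rpow_neg_one]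
      norm_num
    have hn0 : (n : ℝ) ≠ 0 := by
      rintro h0
      simp [ht, h0] at ht0
    rw [harg, mul_pow, hpow, ht, hZdef]
    have := hpos N
    field_simp
  rw [hLHS]
  calc |Z / t * G - s⁻¹ * ζ * I| = |Z / t * (G - I) + (Z / t - ζ / s) * I| := by
        congr 1; ring
    _ ≤ |Z / t| * |G - I| + |Z / t - ζ / s| * |I| := by
        refine (abs_add_le _ _).trans_eq ?_
        rw [abs_mul, abs_mul]
    _ ≤ (ζ + 1) / (κ / 2) * (C₁ * η) + C₂ * η * (M ^ 2 * CK) := by gcongr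
    _ = C * η := by rw [hC]; ring
    _ < ε := hηε
end

section
/- Let a ∈ ℝ, let w : [0,1] → ℝ be continuous with w(0) = 0, and let (u_{N,i}), 1 ≤ i ≤ N, be a triangular array of reals such that sup_{s∈[0,1]} | N^{−1/2} ∑_{i=1}^{⌊Ns⌋} u_{N,i} − w(s) | → 0 as N → ∞. Then sup_{s∈[0,1]} | N^{−1/2} ∑_{i=1}^{⌊Ns⌋} (1 + a/N)^{⌊Ns⌋ − i} u_{N,i} − ( w(s) + a ∫_0^s e^{a(s−r)} w(r) dr ) | → 0 as N → ∞ (along integers N > |a|). -/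
open Set in
/-- If `V' = a g` and `g` varies by at most `η` on `[x, x + h]`, one Euler step for `V` has local
error at most `|a| η h`. -/
theorem abs_euler_step_sub_le {V g : ℝ → ℝ} {a x h η : ℝ} (hh : 0 ≤ h)
    (hV : ∀ t, HasDerivAt V (a * g t) t) (hg : ∀ t ∈ Icc x (x + h), |g t - g x| ≤ η) :
    |V (x + h) - V x - h * (a * g x)| ≤ |a| * η * h := by
  have hderiv : ∀ t ∈ Icc x (x + h),
      HasDerivWithinAt (fun t => V t - t * (a * g x)) (a * g t - 1 * (a * g x))
        (Icc x (x + h)) t := fun t _ =>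
    ((hV t).sub ((hasDerivAt_id t).mul_const (a * g x))).hasDerivWithinAt
  have hbound : ∀ t ∈ Icc x (x + h), ‖a * g t - 1 * (a * g x)‖ ≤ |a| * η := by
    intro t ht
    rw [one_mul, ← mul_sub, Real.norm_eq_abs, abs_mul]
    exact mul_le_mul_of_nonneg_left (hg t ht) (abs_nonneg a)
  have key := (convex_Icc x (x + h)).norm_image_sub_le_of_norm_hasDerivWithin_le hderiv hbound
    (left_mem_Icc.2 (by linarith)) (right_mem_Icc.2 (by linarith))
  rw [Real.norm_eq_abs, Real.norm_eq_abs, add_sub_cancel_left, abs_of_nonneg hh] at key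
  convert key using 2
  ring

/-- Discrete Grönwall inequality with constant forcing. -/
theorem le_of_succ_le_one_add_mul {e : ℕ → ℝ} {b c : ℝ} {N : ℕ} (hb : 0 ≤ b) (h0 : e 0 ≤ 0)
    (hstep : ∀ n < N, e (n + 1) ≤ (1 + b) * e n + b * c) :
    ∀ n ≤ N, e n ≤ ((1 + b) ^ n - 1) * c := by
  intro n
  induction n with
  | zero => simpa using h0
  | succ n ih =>
    intro hn
    calc e (n + 1) ≤ (1 + b) * e n + b * c := hstep n hn
      _ ≤ (1 + b) * (((1 + b) ^ n - 1) * c) + b * c := by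
          have := ih (by omega)
          gcongr
      _ = ((1 + b) ^ (n + 1) - 1) * c := by ring

theorem sum_Icc_succ_pow_sub_mul (ρ : ℝ) (u : ℕ → ℝ) (n : ℕ) :
    ∑ i ∈ Finset.Icc 1 (n + 1), ρ ^ (n + 1 - i) * u i =
      ρ * ∑ i ∈ Finset.Icc 1 n, ρ ^ (n - i) * u i + u (n + 1) := by
  rw [Finset.sum_Icc_succ_top (by omega), Finset.mul_sum]
  congr 1
  · refine Finset.sum_congr rfl fun i hi => ?_
    rw [Nat.sub_add_comm (Finset.mem_Icc.1 hi).2, pow_succ]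
    ring
  · simp

theorem hasDerivAt_integral_exp_mul {w : ℝ → ℝ} (hw : Continuous w) (a s : ℝ) :
    HasDerivAt (fun s => a * ∫ r in (0 : ℝ)..s, Real.exp (a * (s - r)) * w r)
      (a * (w s + a * ∫ r in (0 : ℝ)..s, Real.exp (a * (s - r)) * w r)) s := by
  have hfactor : ∀ s, ∫ r in (0 : ℝ)..s, Real.exp (a * (s - r)) * w r =
      Real.exp (a * s) * ∫ r in (0 : ℝ)..s, Real.exp (-(a * r)) * w r := by
    intro s
    rw [← intervalIntegral.integral_const_mul]
    congr 1 with r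
    rw [← mul_assoc, ← Real.exp_add]
    ring_nf
  simp only [hfactor]
  have hint : HasDerivAt (fun s => ∫ r in (0 : ℝ)..s, Real.exp (-(a * r)) * w r)
      (Real.exp (-(a * s)) * w s) s :=
    ((by fun_prop : Continuous fun r => Real.exp (-(a * r)) * w r).integral_hasStrictDerivAt
      0 s).hasDerivAt
  have hexp : HasDerivAt (fun s => Real.exp (a * s)) (Real.exp (a * s) * (a * 1)) s :=
    ((hasDerivAt_id s).const_mul a).exp
  have hcancel : Real.exp (a * s) * Real.exp (-(a * s)) = 1 := by rw [← Real.exp_add]; simp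
  refine ((hexp.mul hint).const_mul a).congr_deriv ?_
  linear_combination (a * w s) * hcancel

/-- Comparison of the normalised autoregression with its continuous-time limit at the grid
points `n / N`. -/
theorem abs_weighted_sum_sub_le {V w : ℝ → ℝ} {u : ℕ → ℝ} {a c η : ℝ} {N : ℕ} (hN : 0 < N)
    (hV0 : V 0 = 0) (hV : ∀ t, HasDerivAt V (a * (w t + V t)) t)
    (hosc : ∀ x ∈ Set.Icc (0 : ℝ) 1, ∀ y ∈ Set.Icc (0 : ℝ) 1, |x - y| ≤ 1 / N →
      |w x + V x - (w y + V y)| ≤ η)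
    (hu : ∀ n ≤ N, |c * ∑ i ∈ Finset.Icc 1 n, u i - w (n / N)| ≤ η) (n : ℕ) (hn : n ≤ N) :
    |c * ∑ i ∈ Finset.Icc 1 n, (1 + a / N) ^ (n - i) * u i - (w (n / N) + V (n / N))| ≤
      (2 * Real.exp |a| - 1) * η := by
  have hNpos : (0 : ℝ) < N := by exact_mod_cast hN
  have hη : 0 ≤ η := (abs_nonneg _).trans (hu 0 (Nat.zero_le _))
  set S : ℕ → ℝ := fun n => c * ∑ i ∈ Finset.Icc 1 n, u i with hS
  set X : ℕ → ℝ := fun n => c * ∑ i ∈ Finset.Icc 1 n, (1 + a / N) ^ (n - i) * u i with hX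
  have hXrec : ∀ n, X (n + 1) - S (n + 1) = (1 + a / N) * (X n - S n) + a / N * S n := by
    intro n
    simp only [hX, hS, sum_Icc_succ_pow_sub_mul]
    rw [Finset.sum_Icc_succ_top (Nat.le_add_left 1 n)]
    ring
  have hstep : ∀ n < N, |X (n + 1) - S (n + 1) - V ((n + 1 : ℕ) / N)| ≤
      (1 + |a| / N) * |X n - S n - V (n / N)| + |a| / N * (2 * η) := by
    intro n hn
    have hn1 : (n : ℝ) + 1 ≤ N := by exact_mod_cast hn
    have hgrid : (n : ℝ) / N + 1 / N ≤ 1 := by rw [← add_div]; exact (div_le_one hNpos).2 hn1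
    have hn0 : (0 : ℝ) ≤ n / N := by positivity
    have hh : (0 : ℝ) ≤ 1 / N := by positivity
    have heuler := abs_euler_step_sub_le (g := fun t => w t + V t) (x := n / N) (η := η) hh hV
      fun t ht => hosc t ⟨hn0.trans ht.1, ht.2.trans hgrid⟩ _ ⟨hn0, by linarith⟩
        (by rw [abs_of_nonneg (by linarith [ht.1])]; linarith [ht.2])
    rw [← add_div, ← Nat.cast_succ] at heuler
    have hdecomp : X (n + 1) - S (n + 1) - V ((n + 1 : ℕ) / N) =
        (1 + a / N) * (X n - S n - V (n / N)) + a / N * (S n - w (n / N)) -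
          (V ((n + 1 : ℕ) / N) - V (n / N) - 1 / N * (a * (w (n / N) + V (n / N)))) := by
      rw [hXrec]
      ring
    have hρ : |1 + a / N| ≤ 1 + |a| / N := by
      simpa [abs_div] using abs_add_le 1 (a / N)
    have hforce : |a / N * (S n - w (n / N))| ≤ |a| / N * η := by
      rw [abs_mul, abs_div, Nat.abs_cast]
      exact mul_le_mul_of_nonneg_left (hu n hn.le) (by positivity)
    rw [hdecomp]
    calc _ ≤ |(1 + a / N) * (X n - S n - V (n / N))| + |a / N * (S n - w (n / N))| +
          |V ((n + 1 : ℕ) / N) - V (n / N) - 1 / N * (a * (w (n / N) + V (n / N)))| :=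
            (abs_sub _ _).trans (add_le_add_left (abs_add_le _ _) _)
      _ ≤ (1 + |a| / N) * |X n - S n - V (n / N)| + |a| / N * η + |a| * η * (1 / N) := by
          rw [abs_mul]
          gcongr
      _ = _ := by ring
  have hgronwall := le_of_succ_le_one_add_mul
    (e := fun n : ℕ => |X n - S n - V (n / N)|) (by positivity : (0 : ℝ) ≤ |a| / N)
    (by simp [hX, hS, hV0]) hstep n hn
  have hpow : (1 + |a| / N) ^ n ≤ Real.exp |a| :=
    calc (1 + |a| / N) ^ n ≤ (1 + |a| / N) ^ N :=
          pow_le_pow_right₀ (le_add_of_nonneg_right (by positivity)) hn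
      _ ≤ Real.exp (|a| / N) ^ N := by
          gcongr
          linarith [Real.add_one_le_exp (|a| / N)]
      _ = Real.exp |a| := by rw [← Real.exp_nat_mul, mul_div_cancel₀ _ hNpos.ne']
  calc |X n - (w (n / N) + V (n / N))| =
        |X n - S n - V (n / N) + (S n - w (n / N))| := by ring_nf
    _ ≤ |X n - S n - V (n / N)| + |S n - w (n / N)| := abs_add_le _ _
    _ ≤ (Real.exp |a| - 1) * (2 * η) + η := by
        refine add_le_add (hgronwall.trans ?_) (hu n hn)
        gcongr
    _ = (2 * Real.exp |a| - 1) * η := by ring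

/-- Local-to-unity core. Let `a ∈ ℝ`, `w : [0,1] → ℝ` continuous with
`w(0) = 0`, and `(u_{N,i})` a triangular array with
`sup_{s∈[0,1]} |N^{−1/2} ∑_{i=1}^{⌊Ns⌋} u_{N,i} − w(s)| → 0`. Then
`sup_{s∈[0,1]} |N^{−1/2} ∑_{i=1}^{⌊Ns⌋} (1 + a/N)^{⌊Ns⌋−i} u_{N,i}
  − (w(s) + a ∫_0^s e^{a(s−r)} w(r) dr)| → 0` (along integers `N > |a|`). -/
theorem local_to_unity_ornstein_uhlenbeck (a : ℝ)
    (w : ℝ → ℝ) (hw : ContinuousOn w (Set.Icc (0 : ℝ) 1)) (hw0 : w 0 = 0)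
    (u : ℕ → ℕ → ℝ)
    (hu : ∀ ε > (0 : ℝ), ∃ N₀ : ℕ, ∀ N : ℕ, N₀ ≤ N → ∀ s ∈ Set.Icc (0 : ℝ) 1,
      |(N : ℝ) ^ (-(1 / 2) : ℝ) * ∑ i ∈ Finset.Icc 1 ⌊(N : ℝ) * s⌋.toNat, u N i - w s| < ε) :
    ∀ ε > (0 : ℝ), ∃ N₀ : ℕ, ∀ N : ℕ, N₀ ≤ N → (N : ℝ) > |a| → ∀ s ∈ Set.Icc (0 : ℝ) 1,
      |(N : ℝ) ^ (-(1 / 2) : ℝ) *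
          (∑ i ∈ Finset.Icc 1 ⌊(N : ℝ) * s⌋.toNat,
            (1 + a / (N : ℝ)) ^ (⌊(N : ℝ) * s⌋.toNat - i) * u N i) -
        (w s + a * ∫ r in (0 : ℝ)..s, Real.exp (a * (s - r)) * w r)| < ε := by
  intro ε hε
  set w' : ℝ → ℝ := Set.IccExtend zero_le_one (Set.domRestrict (Set.Icc (0 : ℝ) 1) w) with hw'
  have hw'c : Continuous w' := (continuousOn_iff_continuous_domRestrict.1 hw).Icc_extend'
  have hww' : ∀ s ∈ Set.Icc (0 : ℝ) 1, w' s = w s := fun s hs =>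
    Set.IccExtend_of_mem zero_le_one _ hs
  set V : ℝ → ℝ := fun s => a * ∫ r in (0 : ℝ)..s, Real.exp (a * (s - r)) * w' r with hVdef
  have hV : ∀ t, HasDerivAt V (a * (w' t + V t)) t := hasDerivAt_integral_exp_mul hw'c a
  have hVw : ∀ s ∈ Set.Icc (0 : ℝ) 1,
      V s = a * ∫ r in (0 : ℝ)..s, Real.exp (a * (s - r)) * w r := by
    intro s hs
    simp only [hVdef]
    congr 1
    refine intervalIntegral.integral_congr fun r hr => ?_
    rw [Set.uIcc_of_le hs.1] at hr
    simp only [hww' r ⟨hr.1, hr.2.trans hs.2⟩]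
  have hVc : Continuous V := continuous_iff_continuousAt.2 fun t => (hV t).continuousAt
  have hη : 0 < ε / (2 * Real.exp |a|) := by positivity
  set η := ε / (2 * Real.exp |a|) with hηdef
  obtain ⟨δ, hδ, hosc⟩ := Metric.uniformContinuousOn_iff.1
    (isCompact_Icc.uniformContinuousOn_of_continuous
      (hw'c.add hVc).continuousOn : UniformContinuousOn _ (Set.Icc (0 : ℝ) 1)) η hη
  obtain ⟨N₁, hN₁⟩ := hu η hη
  obtain ⟨N₂, hN₂⟩ := exists_nat_gt (1 / δ)
  refine ⟨max N₁ N₂, fun N hN hNa s hs => ?_⟩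
  have hNpos : (0 : ℝ) < N := (abs_nonneg a).trans_lt hNa
  have hinv : 1 / (N : ℝ) < δ := by
    rw [one_div_lt hNpos hδ]
    exact hN₂.trans_le (by exact_mod_cast (le_max_right _ _).trans hN)
  set n := ⌊(N : ℝ) * s⌋.toNat with hn
  have hns : n = ⌊(N : ℝ) * s⌋₊ := rfl
  have hNs : 0 ≤ (N : ℝ) * s := mul_nonneg hNpos.le hs.1
  have hfloor : (n : ℝ) ≤ N * s := hns ▸ Nat.floor_le hNs
  have hfloor' : (N : ℝ) * s < n + 1 := hns ▸ Nat.lt_floor_add_one _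
  have hnN : n ≤ N := by
    have : (n : ℝ) ≤ N := hfloor.trans (mul_le_of_le_one_right hNpos.le hs.2)
    exact_mod_cast this
  have hmem : ∀ m ≤ N, (m : ℝ) / N ∈ Set.Icc (0 : ℝ) 1 := fun m hm =>
    ⟨by positivity, (div_le_one hNpos).2 (by exact_mod_cast hm)⟩
  have hgrid := abs_weighted_sum_sub_le (u := u N) (c := (N : ℝ) ^ (-(1 / 2) : ℝ)) (η := η)
    (by exact_mod_cast hNpos) (by simp [hVdef]) hV
    (fun x hx y hy hxy => (hosc x hx y hy (hxy.trans_lt hinv)).le)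
    (fun m hm => by
      have := hN₁ N ((le_max_left _ _).trans hN) _ (hmem m hm)
      rw [mul_div_cancel₀ _ hNpos.ne', Int.floor_natCast, Int.toNat_natCast,
        ← hww' _ (hmem m hm)] at this
      exact this.le) n hnN
  have hclose : |w' (n / N) + V (n / N) - (w' s + V s)| < η := by
    refine hosc _ (hmem n hnN) s hs (lt_of_le_of_lt ?_ hinv)
    rw [Real.dist_eq, abs_sub_comm, abs_of_nonneg
      (sub_nonneg.2 ((div_le_iff₀' hNpos).2 hfloor)), sub_le_iff_le_add, ← add_div,
      le_div_iff₀' hNpos]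
    linarith
  rw [← hww' s hs, ← hVw s hs]
  calc _ ≤ _ := abs_sub_le _ (w' (n / N) + V (n / N)) _
    _ < (2 * Real.exp |a| - 1) * η + η := add_lt_add_of_le_of_lt hgrid hclose
    _ = ε := by rw [hηdef]; field_simp; ring
end

section
/- Let ϑ ∈ (0,1), let v : [ϑ,1] → ℝ be continuous with v(ϑ) = 0, and let (y_{N,i}), 0 ≤ i ≤ N, be a triangular array of reals. Assume: (i) sup_{s∈[0,ϑ)} | ∫_0^s N^{1/2} y_{N,⌊Nt⌋} dt − w(s) | → 0 for some continuous w : [0,ϑ] → ℝ; (ii) sup_{s∈[ϑ,1]} | N^{−1/2} ( y_{N,⌊Ns⌋} − y_{N,⌊Nϑ⌋} ) − v(s) | → 0; and (iii) N^{−1/2} y_{N,⌊Nϑ⌋} → 0. Then sup_{s∈[0,1]} | ∫_0^s N^{−1/2} y_{N,⌊Nt⌋} dt − 𝟙(s ≥ ϑ) ∫_ϑ^s v(t) dt | → 0 as N → ∞. -/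
/-- The step function `t ↦ g ⌊c t⌋` is interval integrable on every bounded interval. -/
theorem intervalIntegrable_comp_floor_toNat (g : ℕ → ℝ) {c : ℝ} (hc : 0 ≤ c) (a b : ℝ) :
    IntervalIntegrable (fun t : ℝ => g ⌊c * t⌋.toNat) MeasureTheory.volume a b := by
  rw [intervalIntegrable_iff]
  have hmeas : Measurable fun t : ℝ => g ⌊c * t⌋.toNat :=
    (measurable_from_top (f := fun n : ℤ => g n.toNat)).comp
      (Int.measurable_floor.comp (measurable_const_mul c))
  refine MeasureTheory.Measure.integrableOn_of_bounded
    (M := ∑ i ∈ Finset.range (⌊c * max a b⌋.toNat + 1), |g i|)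
    (by simp [Set.uIoc]) hmeas.aestronglyMeasurable ?_
  refine (MeasureTheory.ae_restrict_iff' measurableSet_uIoc).2 (.of_forall fun t ht => ?_)
  refine Finset.single_le_sum (f := fun i => |g i|) (fun i _ => abs_nonneg _) ?_
  rw [Finset.mem_range, Nat.lt_succ_iff]
  exact Int.toNat_le_toNat (Int.floor_le_floor (mul_le_mul_of_nonneg_left ht.2 hc))

/-- A bound for the primitive of a locally integrable function on `[a, b)` extends to `[a, b]`. -/
theorem abs_integral_le_of_forall_lt {f : ℝ → ℝ}
    (hf : ∀ a b, IntervalIntegrable f MeasureTheory.volume a b) {a b C : ℝ} (hab : a < b)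
    (h : ∀ s, a ≤ s → s < b → |∫ t in a..s, f t| ≤ C) :
    ∀ s ∈ Set.Icc a b, |∫ t in a..s, f t| ≤ C := by
  have hcl : IsClosed {s : ℝ | |∫ t in a..s, f t| ≤ C} :=
    isClosed_le (intervalIntegral.continuous_primitive hf a).abs continuous_const
  intro s hs
  rw [← closure_Ico hab.ne] at hs
  exact closure_minimal (fun s hs => h s hs.1 hs.2) hcl hs

/-- Deterministic core of Lemma 4.1 (I(0)-to-I(1) change-point). Let
`ϑ ∈ (0,1)`, `v : [ϑ,1] → ℝ` continuous with `v(ϑ) = 0`, and `(y_{N,i})` a triangular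
array such that (i) `sup_{s∈[0,ϑ)} |∫_0^s N^{1/2} y_{N,⌊Nt⌋} dt − w(s)| → 0` for some
continuous `w : [0,ϑ] → ℝ`, (ii) `sup_{s∈[ϑ,1]} |N^{−1/2}(y_{N,⌊Ns⌋} − y_{N,⌊Nϑ⌋}) − v(s)| → 0`,
and (iii) `N^{−1/2} y_{N,⌊Nϑ⌋} → 0`. Then
`sup_{s∈[0,1]} |∫_0^s N^{−1/2} y_{N,⌊Nt⌋} dt − 𝟙(s ≥ ϑ) ∫_ϑ^s v(t) dt| → 0`. -/
theorem change_point_I0_to_I1_integrated_path (ϑ : ℝ) (hϑ : ϑ ∈ Set.Ioo (0 : ℝ) 1)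
    (v : ℝ → ℝ) (hv : ContinuousOn v (Set.Icc ϑ 1)) (hvϑ : v ϑ = 0)
    (w : ℝ → ℝ) (hw : ContinuousOn w (Set.Icc (0 : ℝ) ϑ))
    (y : ℕ → ℕ → ℝ)
    (hpre : ∀ ε > (0 : ℝ), ∃ N₀ : ℕ, ∀ N : ℕ, N₀ ≤ N → ∀ s : ℝ, 0 ≤ s → s < ϑ →
      |(∫ t in (0 : ℝ)..s, (N : ℝ) ^ ((1 / 2) : ℝ) * y N ⌊(N : ℝ) * t⌋.toNat) - w s| < ε)
    (hpost : ∀ ε > (0 : ℝ), ∃ N₀ : ℕ, ∀ N : ℕ, N₀ ≤ N → ∀ s ∈ Set.Icc ϑ 1,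
      |(N : ℝ) ^ (-(1 / 2) : ℝ) * (y N ⌊(N : ℝ) * s⌋.toNat - y N ⌊(N : ℝ) * ϑ⌋.toNat) - v s| < ε)
    (hϑ0 : Filter.Tendsto (fun N : ℕ => (N : ℝ) ^ (-(1 / 2) : ℝ) * y N ⌊(N : ℝ) * ϑ⌋.toNat)
      Filter.atTop (nhds 0)) :
    ∀ ε > (0 : ℝ), ∃ N₀ : ℕ, ∀ N : ℕ, N₀ ≤ N → ∀ s ∈ Set.Icc (0 : ℝ) 1,
      |(∫ t in (0 : ℝ)..s, (N : ℝ) ^ (-(1 / 2) : ℝ) * y N ⌊(N : ℝ) * t⌋.toNat) -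
        (if ϑ ≤ s then ∫ t in ϑ..s, v t else 0)| < ε := by
  intro ε hε
  obtain ⟨M, hM⟩ := isCompact_Icc.exists_bound_of_continuousOn hw
  obtain ⟨N₁, h₁⟩ := hpre 1 one_pos
  obtain ⟨N₂, h₂⟩ := hpost (ε / 4) (by positivity)
  obtain ⟨N₃, h₃⟩ := Metric.tendsto_atTop.1 hϑ0 (ε / 4) (by positivity)
  obtain ⟨N₄, h₄⟩ := exists_nat_gt ((M + 1) / (ε / 2))
  refine ⟨max (max N₁ N₂) (max N₃ (max N₄ 1)), fun N hN s hs => ?_⟩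
  simp only [max_le_iff] at hN
  obtain ⟨⟨hN₁, hN₂⟩, hN₃, hN₄, hN_pos⟩ := hN
  have hN0 : (0 : ℝ) < N := by exact_mod_cast hN_pos
  have hint : ∀ a b, IntervalIntegrable
      (fun t : ℝ => (N : ℝ) ^ (-(1 / 2) : ℝ) * y N ⌊(N : ℝ) * t⌋.toNat)
      MeasureTheory.volume a b := fun a b =>
    (intervalIntegrable_comp_floor_toNat (y N) hN0.le a b).const_mul _
  have hpow : (N : ℝ) ^ (-(1 / 2) : ℝ) = (N : ℝ)⁻¹ * (N : ℝ) ^ ((1 / 2) : ℝ) := by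
    rw [← Real.rpow_neg_one, ← Real.rpow_add hN0]
    norm_num
  have hsmall : (N : ℝ)⁻¹ * (M + 1) < ε / 2 := by
    have h : (M + 1) / (ε / 2) < N := h₄.trans_le (by exact_mod_cast hN₄)
    rw [div_lt_iff₀ (by positivity)] at h
    rwa [inv_mul_lt_iff₀ hN0]
  have hpre_small : ∀ s ∈ Set.Icc 0 ϑ,
      |∫ t in (0 : ℝ)..s, (N : ℝ) ^ (-(1 / 2) : ℝ) * y N ⌊(N : ℝ) * t⌋.toNat|
        ≤ (N : ℝ)⁻¹ * (M + 1) := by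
    refine abs_integral_le_of_forall_lt hint hϑ.1 fun s hs0 hsϑ => ?_
    simp only [hpow, mul_assoc]
    rw [intervalIntegral.integral_const_mul, abs_mul, abs_of_pos (inv_pos.2 hN0)]
    refine mul_le_mul_of_nonneg_left ?_ (inv_pos.2 hN0).le
    have hw_s := hM s ⟨hs0, hsϑ.le⟩
    rw [Real.norm_eq_abs] at hw_s
    have hdist := abs_lt.1 (h₁ N hN₁ s hs0 hsϑ)
    have hw_s' := abs_le.1 hw_s
    exact abs_le.2 ⟨by linarith, by linarith⟩
  split_ifs with hϑs
  · have hvint : IntervalIntegrable v MeasureTheory.volume ϑ s :=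
      (hv.mono (Set.Icc_subset_Icc_right hs.2)).intervalIntegrable_of_Icc hϑs
    rw [← intervalIntegral.integral_add_adjacent_intervals (hint 0 ϑ) (hint ϑ s), add_sub_assoc,
      ← intervalIntegral.integral_sub (hint ϑ s) hvint]
    have hpost_small : |∫ t in ϑ..s,
        ((N : ℝ) ^ (-(1 / 2) : ℝ) * y N ⌊(N : ℝ) * t⌋.toNat - v t)| ≤ ε / 2 * |s - ϑ| := by
      refine intervalIntegral.norm_integral_le_of_norm_le_const (E := ℝ) fun t ht => ?_
      rw [Set.uIoc_of_le hϑs] at ht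
      have hincr := abs_lt.1 (h₂ N hN₂ t ⟨ht.1.le, ht.2.trans hs.2⟩)
      have hstart := h₃ N hN₃
      rw [Real.dist_eq, sub_zero] at hstart
      have hstart' := abs_lt.1 hstart
      rw [mul_sub] at hincr
      exact abs_le.2 ⟨by linarith, by linarith⟩
    have hlen : |s - ϑ| ≤ 1 := by
      rw [abs_of_nonneg (sub_nonneg.2 hϑs)]
      linarith [hs.2, hϑ.1]
    calc _ ≤ _ := abs_add_le _ _
      _ < ε / 2 + ε / 2 := add_lt_add_of_lt_of_le
        ((hpre_small ϑ ⟨hϑ.1.le, le_rfl⟩).trans_lt hsmall)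
        (hpost_small.trans (mul_le_of_le_one_right (by positivity) hlen))
      _ = ε := add_halves ε
  · rw [sub_zero]
    linarith [hpre_small s ⟨hs.1, (not_le.1 hϑs).le⟩]
end

section
/- Let ϑ ∈ (0,1), let w : [0,ϑ] → ℝ be continuous, and let (y_{N,i}), 0 ≤ i ≤ N, be a triangular array of reals. Assume: (i) sup_{s∈[0,ϑ)} | N^{−1/2} y_{N,⌊Ns⌋} − w(s) | → 0 as N → ∞; and (ii) sup_{s∈[ϑ,1]} | N^{−1/2} ∑_{i=⌊Nϑ⌋}^{⌊Ns⌋} y_{N,i} | remains bounded as N → ∞. Then sup_{s∈[0,1]} | ∫_0^s N^{−1/2} y_{N,⌊Nt⌋} dt − ∫_0^{min(s,ϑ)} w(t) dt | → 0 as N → ∞. -/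
open MeasureTheory in
/-- On the unit cell starting at `k`, a function of the integer part is constant. -/
lemma intervalIntegral_floor_cell (x : ℕ → ℝ) (k : ℕ) {u : ℝ} (hk : (k : ℝ) ≤ u)
    (hu : u ≤ k + 1) :
    IntervalIntegrable (fun t : ℝ => x ⌊t⌋₊) volume k u ∧
      ∫ t in (k : ℝ)..u, x ⌊t⌋₊ = (u - k) * x k := by
  have hfloor : ∀ t ∈ Set.Ioo (k : ℝ) u, x ⌊t⌋₊ = x k := fun t ht => by
    rw [(Nat.floor_eq_iff (k.cast_nonneg.trans ht.1.le)).2 ⟨ht.1.le, ht.2.trans_le hu⟩]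
  have hae : ∀ᵐ t ∂(volume : Measure ℝ), t ∈ Set.uIoc (k : ℝ) u → x ⌊t⌋₊ = x k := by
    have hne : ∀ᵐ t ∂(volume : Measure ℝ), t ≠ u := by simp [ae_iff]
    filter_upwards [hne] with t ht hmem
    rw [Set.uIoc_of_le hk] at hmem
    exact hfloor t ⟨hmem.1, lt_of_le_of_ne hmem.2 ht⟩
  refine ⟨?_, ?_⟩
  · refine (intervalIntegrable_const (c := x k)).congr_ae ?_
    rw [Filter.EventuallyEq, ae_restrict_iff' measurableSet_uIoc]
    filter_upwards [hae] with t ht hmem using (ht hmem).symm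
  · rw [intervalIntegral.integral_congr_ae hae, intervalIntegral.integral_const, smul_eq_mul]

open MeasureTheory in
/-- The integral of a step function of the integer part is a linearly interpolated partial sum. -/
lemma intervalIntegral_floor (x : ℕ → ℝ) {u : ℝ} (hu : 0 ≤ u) :
    IntervalIntegrable (fun t : ℝ => x ⌊t⌋₊) volume 0 u ∧
      ∫ t in (0 : ℝ)..u, x ⌊t⌋₊ =
        (∑ i ∈ Finset.range ⌊u⌋₊, x i) + (u - ⌊u⌋₊) * x ⌊u⌋₊ := by
  have hcell : ∀ k : ℕ, IntervalIntegrable (fun t : ℝ => x ⌊t⌋₊) volume k (k + 1 : ℕ) ∧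
      ∫ t in (k : ℝ)..(k + 1 : ℕ), x ⌊t⌋₊ = x k := fun k => by
    simpa using intervalIntegral_floor_cell x k (u := (k + 1 : ℕ)) (by simp) (by simp)
  have hnat : IntervalIntegrable (fun t : ℝ => x ⌊t⌋₊) volume (0 : ℕ) (⌊u⌋₊ : ℕ) :=
    IntervalIntegrable.trans_iterate (a := fun k : ℕ => (k : ℝ)) fun k _ => (hcell k).1
  have hsum : ∫ t in ((0 : ℕ) : ℝ)..(⌊u⌋₊ : ℕ), x ⌊t⌋₊ = ∑ i ∈ Finset.range ⌊u⌋₊, x i := by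
    rw [← intervalIntegral.sum_integral_adjacent_intervals (a := fun k : ℕ => (k : ℝ))
      fun k _ => (hcell k).1]
    exact Finset.sum_congr rfl fun k _ => (hcell k).2
  obtain ⟨hint, hlast⟩ :=
    intervalIntegral_floor_cell x ⌊u⌋₊ (Nat.floor_le hu) (Nat.lt_floor_add_one u).le
  rw [Nat.cast_zero] at hnat hsum
  exact ⟨hnat.trans hint, by
    rw [← intervalIntegral.integral_add_adjacent_intervals hnat hint, hsum, hlast]⟩

/-- If the partial sums of `x` from `⌊a⌋₊` up to `⌊b⌋₊` are bounded by `C`, so is, up to a factor,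
the integral of the associated step function over `[a, b]`. -/
lemma abs_intervalIntegral_floor_le (x : ℕ → ℝ) {a b C : ℝ} (ha : 0 ≤ a) (hab : a ≤ b)
    (hC : ∀ k, ⌊a⌋₊ ≤ k → k ≤ ⌊b⌋₊ → |∑ i ∈ Finset.Icc ⌊a⌋₊ k, x i| ≤ C) :
    |∫ t in a..b, x ⌊t⌋₊| ≤ 4 * C := by
  have hb : 0 ≤ b := ha.trans hab
  obtain ⟨ia, ea⟩ := intervalIntegral_floor x ha
  obtain ⟨ib, eb⟩ := intervalIntegral_floor x hb
  have hmK : ⌊a⌋₊ ≤ ⌊b⌋₊ := Nat.floor_mono hab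
  have hfa := Nat.floor_le ha
  have hfa' := Nat.lt_floor_add_one a
  have hfb := Nat.floor_le hb
  have hfb' := Nat.lt_floor_add_one b
  rw [← intervalIntegral.integral_interval_sub_left ib ia, ea, eb]
  generalize ⌊a⌋₊ = m at *
  generalize ⌊b⌋₊ = K at *
  have hxm : |x m| ≤ C := by simpa using hC m le_rfl hmK
  have hsplit : ∑ i ∈ Finset.Icc m K, x i =
      ∑ i ∈ Finset.range K, x i - ∑ i ∈ Finset.range m, x i + x K := by
    rw [← Finset.Ico_add_one_right_eq_Icc, Finset.sum_Ico_succ_top hmK,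
      Finset.sum_Ico_eq_sub _ hmK]
  have hSK := hC K hmK le_rfl
  have hxK : |x K| ≤ 2 * C := by
    rcases hmK.eq_or_lt with rfl | hlt
    · linarith [abs_nonneg (x m)]
    · obtain ⟨j, rfl⟩ : ∃ j, K = j + 1 := ⟨K - 1, by omega⟩
      have hSj := hC j (by omega) (by omega)
      rw [Finset.sum_Icc_succ_top (by omega)] at hSK
      rw [abs_le] at *
      constructor <;> linarith
  have h1 : |(1 - (b - K)) * x K| ≤ 2 * C := by
    rw [abs_mul, abs_of_nonneg (by linarith : 0 ≤ 1 - (b - (K : ℝ)))]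
    nlinarith [abs_nonneg (x K)]
  have h2 : |(a - m) * x m| ≤ C := by
    rw [abs_mul, abs_of_nonneg (by linarith : 0 ≤ a - (m : ℝ))]
    nlinarith [abs_nonneg (x m)]
  rw [abs_le] at *
  constructor <;> linarith


/-- Deterministic core of Lemma 4.2 (I(1)-to-I(0) change-point). Let
`ϑ ∈ (0,1)`, `w : [0,ϑ] → ℝ` continuous, and `(y_{N,i})` a triangular array such that
(i) `sup_{s∈[0,ϑ)} |N^{−1/2} y_{N,⌊Ns⌋} − w(s)| → 0`, and (ii)
`sup_{s∈[ϑ,1]} |N^{−1/2} ∑_{i=⌊Nϑ⌋}^{⌊Ns⌋} y_{N,i}|` remains bounded as `N → ∞`. Then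
`sup_{s∈[0,1]} |∫_0^s N^{−1/2} y_{N,⌊Nt⌋} dt − ∫_0^{min(s,ϑ)} w(t) dt| → 0`. -/
theorem change_point_I1_to_I0_integrated_path (ϑ : ℝ) (hϑ : ϑ ∈ Set.Ioo (0 : ℝ) 1)
    (w : ℝ → ℝ) (hw : ContinuousOn w (Set.Icc (0 : ℝ) ϑ))
    (y : ℕ → ℕ → ℝ)
    (hpre : ∀ ε > (0 : ℝ), ∃ N₀ : ℕ, ∀ N : ℕ, N₀ ≤ N → ∀ s : ℝ, 0 ≤ s → s < ϑ →
      |(N : ℝ) ^ (-(1 / 2) : ℝ) * y N ⌊(N : ℝ) * s⌋.toNat - w s| < ε)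
    (hpost : ∃ C : ℝ, ∃ N₁ : ℕ, ∀ N : ℕ, N₁ ≤ N → ∀ s ∈ Set.Icc ϑ 1,
      |(N : ℝ) ^ (-(1 / 2) : ℝ) *
        ∑ i ∈ Finset.Icc ⌊(N : ℝ) * ϑ⌋.toNat ⌊(N : ℝ) * s⌋.toNat, y N i| ≤ C) :
    ∀ ε > (0 : ℝ), ∃ N₀ : ℕ, ∀ N : ℕ, N₀ ≤ N → ∀ s ∈ Set.Icc (0 : ℝ) 1,
      |(∫ t in (0 : ℝ)..s, (N : ℝ) ^ (-(1 / 2) : ℝ) * y N ⌊(N : ℝ) * t⌋.toNat) -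
        ∫ t in (0 : ℝ)..(min s ϑ), w t| < ε := by
  intro ε hε
  obtain ⟨hϑ0, hϑ1⟩ := hϑ
  obtain ⟨N₀, hN₀⟩ := hpre (ε / 2) (half_pos hε)
  obtain ⟨C, N₁, hN₁⟩ := hpost
  obtain ⟨N₂, hN₂⟩ := exists_nat_gt (4 * C / (ε / 2))
  refine ⟨max (max N₀ N₁) (max N₂ 1), fun N hN s hs => ?_⟩
  simp only [max_le_iff] at hN
  obtain ⟨⟨hNN₀, hNN₁⟩, hNN₂, hN1⟩ := hN
  have hNpos : (0 : ℝ) < N := by exact_mod_cast hN1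
  have hpre' := hN₀ N hNN₀
  have hpost' := hN₁ N hNN₁
  simp only [Int.floor_toNat] at hpre' hpost' ⊢
  set x : ℕ → ℝ := fun i => (N : ℝ) ^ (-(1 / 2) : ℝ) * y N i with hx
  change |(∫ t in (0 : ℝ)..s, x ⌊(N : ℝ) * t⌋₊) - _| < ε
  have hint : ∀ r : ℝ, 0 ≤ r →
      IntervalIntegrable (fun t : ℝ => x ⌊(N : ℝ) * t⌋₊) MeasureTheory.volume 0 r := by
    intro r hr
    have h := (intervalIntegral_floor x (mul_nonneg hNpos.le hr)).1.comp_mul_left (c := (N : ℝ))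
    simpa [hNpos.ne'] using h
  have hbefore : ∀ r : ℝ, 0 ≤ r → r ≤ ϑ →
      |(∫ t in (0 : ℝ)..r, x ⌊(N : ℝ) * t⌋₊) - ∫ t in (0 : ℝ)..r, w t| ≤ ε / 2 * r := by
    intro r hr hrϑ
    have hwint : IntervalIntegrable w MeasureTheory.volume 0 r :=
      (hw.mono (by rw [Set.uIcc_of_le hr]; exact Set.Icc_subset_Icc_right hrϑ)).intervalIntegrable
    rw [← intervalIntegral.integral_sub (hint r hr) hwint, ← Real.norm_eq_abs]
    have hne : ∀ᵐ t ∂(MeasureTheory.volume : MeasureTheory.Measure ℝ), t ≠ r := by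
      simp [MeasureTheory.ae_iff]
    refine (intervalIntegral.norm_integral_le_of_norm_le_const_ae (C := ε / 2) ?_).trans
      (by rw [sub_zero, abs_of_nonneg hr])
    filter_upwards [hne] with t ht hmem
    rw [Set.uIoc_of_le hr] at hmem
    exact (hpre' t hmem.1.le ((lt_of_le_of_ne hmem.2 ht).trans_le hrϑ)).le
  rcases le_total s ϑ with hsϑ | hsϑ
  · rw [min_eq_left hsϑ]
    nlinarith [hbefore s hs.1 hsϑ, hs.2]
  · rw [min_eq_right hsϑ]
    have hpartial : ∀ k, ⌊(N : ℝ) * ϑ⌋₊ ≤ k → k ≤ ⌊(N : ℝ) * s⌋₊ →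
        |∑ i ∈ Finset.Icc ⌊(N : ℝ) * ϑ⌋₊ k, x i| ≤ C := by
      intro k hk hks
      rw [hx, ← Finset.mul_sum]
      rcases hk.eq_or_lt with rfl | hlt
      · exact hpost' ϑ ⟨le_rfl, hϑ1.le⟩
      · have hkN : (k : ℝ) ≤ N * s := (Nat.le_floor_iff (mul_nonneg hNpos.le hs.1)).1 hks
        have hmul : (N : ℝ) * (k / N) = k := mul_div_cancel₀ _ hNpos.ne'
        have h := hpost' (k / N) ⟨?_, ?_⟩
        · rwa [hmul, Nat.floor_natCast] at h
        · rw [le_div_iff₀ hNpos, mul_comm]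
          exact (Nat.lt_of_floor_lt hlt).le
        · rw [div_le_one hNpos]
          nlinarith [hs.2]
    have hafter : |∫ t in ϑ..s, x ⌊(N : ℝ) * t⌋₊| < ε / 2 := by
      rw [intervalIntegral.integral_comp_mul_left (fun t => x ⌊t⌋₊) hNpos.ne', smul_eq_mul,
        abs_mul, abs_of_pos (inv_pos.2 hNpos), inv_mul_lt_iff₀ hNpos]
      refine (abs_intervalIntegral_floor_le x (mul_nonneg hNpos.le hϑ0.le)
        (mul_le_mul_of_nonneg_left hsϑ hNpos.le) hpartial).trans_lt ?_
      rw [← div_lt_iff₀ (half_pos hε)]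
      exact hN₂.trans_le (by exact_mod_cast hNN₂)
    have hsplit := intervalIntegral.integral_interval_sub_left (hint s hs.1) (hint ϑ hϑ0.le)
    have hϑbound : ε / 2 * ϑ ≤ ε / 2 := by nlinarith
    have hb := hbefore ϑ hϑ0.le le_rfl
    rw [← hsplit] at hafter
    rw [abs_le] at hb
    rw [abs_lt] at *
    constructor <;> linarith
end

section
/- Let ϑ ∈ (0,1), κ ∈ (0,1), let w : [0,ϑ] → ℝ be continuous, and let (y_{N,i}), 0 ≤ i ≤ N, be a triangular array of reals with y_{N,0} = 0. Assume: (i) sup_{s∈[0,ϑ)} | N^{−1/2} y_{N,⌊Ns⌋} − w(s) | → 0 as N → ∞; and (ii) N^{−2} ∑_{i=⌊Nϑ⌋}^{N} y_{N,i}^2 → 0 as N → ∞. Then sup_{s∈[κ,1]} | ⌊Ns⌋^{−2} ∑_{i=1}^{⌊Ns⌋} y_{N,i}^2 − s^{−2} ∫_0^{min(s,ϑ)} w(t)^2 dt | → 0 as N → ∞. -/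
open MeasureTheory Filter Finset

/-- A left Riemann sum whose values are uniformly close to `f` on each cell is close to the
integral of `f`. -/
theorem abs_integral_sub_sum_cells_le {f : ℝ → ℝ} {a : ℕ → ℝ} {b δ : ℝ} {N : ℕ} (hN : 0 < N)
    (hf : ContinuousOn f (Set.Icc 0 b))
    (h : ∀ t, 0 ≤ t → t < b → |f t - a ⌊(N : ℝ) * t⌋₊| ≤ δ) (k : ℕ) (hk : (k : ℝ) / N ≤ b) :
    |(∫ t in (0 : ℝ)..(k / N : ℝ), f t) - (N : ℝ)⁻¹ * ∑ i ∈ range k, a i| ≤ δ * (k / N) := by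
  have hN' : (0 : ℝ) < N := by exact_mod_cast hN
  induction k with
  | zero => simp
  | succ k ih =>
    have hlt : (k : ℝ) / N < ((k + 1 : ℕ) : ℝ) / N := by
      push_cast; gcongr; linarith
    have hk0 : (0 : ℝ) ≤ k / N := by positivity
    have hint : ∀ x z : ℝ, 0 ≤ x → x ≤ z → z ≤ b → IntervalIntegrable f volume x z := by
      intro x z hx hxz hz
      apply ContinuousOn.intervalIntegrable
      rw [Set.uIcc_of_le hxz]
      exact hf.mono (Set.Icc_subset_Icc hx hz)
    have h1 := hint 0 (k / N) le_rfl hk0 (hlt.le.trans hk)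
    have h2 := hint (k / N) (((k + 1 : ℕ) : ℝ) / N) hk0 hlt.le hk
    have hlen : ((k + 1 : ℕ) : ℝ) / N - k / N = (N : ℝ)⁻¹ := by
      push_cast; field_simp; ring
    have hcell : |(∫ t in (k / N : ℝ)..(((k + 1 : ℕ) : ℝ) / N), f t) - (N : ℝ)⁻¹ * a k|
        ≤ δ * (N : ℝ)⁻¹ := by
      have hconst : (∫ t in (k / N : ℝ)..(((k + 1 : ℕ) : ℝ) / N), (f t - a k))
          = (∫ t in (k / N : ℝ)..(((k + 1 : ℕ) : ℝ) / N), f t) - (N : ℝ)⁻¹ * a k := by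
        rw [intervalIntegral.integral_sub h2 (by simp), intervalIntegral.integral_const, hlen,
          smul_eq_mul]
      rw [← hconst, ← Real.norm_eq_abs]
      have := intervalIntegral.norm_integral_le_of_norm_le_const_ae (f := fun t => f t - a k)
        (a := (k / N : ℝ)) (b := ((k + 1 : ℕ) : ℝ) / N) (C := δ) ?_
      · rwa [hlen, abs_of_pos (inv_pos.2 hN')] at this
      · have hne : ∀ᵐ t : ℝ, t ≠ ((k + 1 : ℕ) : ℝ) / N := by
          simp [ae_iff]
        filter_upwards [hne] with t ht hmem
        rw [Set.uIoc_of_le hlt.le] at hmem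
        have htlt : t < ((k + 1 : ℕ) : ℝ) / N := lt_of_le_of_ne hmem.2 ht
        have hfl : ⌊(N : ℝ) * t⌋₊ = k := by
          rw [Nat.floor_eq_iff (mul_nonneg hN'.le (hk0.trans hmem.1.le))]
          constructor
          · have := (div_lt_iff₀ hN').1 hmem.1; linarith
          · have := (lt_div_iff₀ hN').1 htlt; push_cast at this; linarith
        have := h t (hk0.trans hmem.1.le) (htlt.trans_le hk)
        rwa [hfl] at this
    have ih' := ih (hlt.le.trans hk)
    rw [← intervalIntegral.integral_add_adjacent_intervals h1 h2, sum_range_succ]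
    have e : δ * (((k + 1 : ℕ) : ℝ) / N) = δ * (k / N) + δ * (N : ℝ)⁻¹ := by
      rw [← hlen]; ring
    rw [e]
    rw [abs_le] at *
    constructor <;> nlinarith

/-- Uniform closeness of the partial sums of squares, normalised by `N²`, to the integral of the
squared limit path, with explicit error terms. -/
theorem abs_sum_sq_sub_integral_le {ϑ M δ : ℝ} (hϑ : 0 < ϑ) (hϑ1 : ϑ < 1) (hδ : δ ≤ 1)
    {w : ℝ → ℝ} (hw : ContinuousOn w (Set.Icc 0 ϑ))
    (hM : ∀ t ∈ Set.Icc 0 ϑ, |w t| ≤ M) {z : ℕ → ℝ} (hz0 : z 0 = 0) {N : ℕ} (hN : 0 < N)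
    (hpre : ∀ s : ℝ, 0 ≤ s → s < ϑ → |(N : ℝ) ^ (-(1 / 2) : ℝ) * z ⌊(N : ℝ) * s⌋₊ - w s| ≤ δ)
    {s : ℝ} (hs : s ∈ Set.Icc (0 : ℝ) 1) :
    |((N : ℝ) ^ 2)⁻¹ * (∑ i ∈ Icc 1 ⌊(N : ℝ) * s⌋₊, z i ^ 2) - ∫ t in (0 : ℝ)..(min s ϑ), w t ^ 2|
      ≤ δ * (2 * M + 1) + 2 * (M + 1) ^ 2 * (N : ℝ)⁻¹
        + ((N : ℝ) ^ 2)⁻¹ * ∑ i ∈ Icc ⌊(N : ℝ) * ϑ⌋₊ N, z i ^ 2 := by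
  have hN' : (0 : ℝ) < N := by exact_mod_cast hN
  have hM0 : 0 ≤ M := (abs_nonneg _).trans (hM 0 ⟨le_rfl, hϑ.le⟩)
  have hδ0 : 0 ≤ δ := (abs_nonneg _).trans (hpre 0 le_rfl hϑ)
  have hsq : ∀ i, ((N : ℝ) ^ (-(1 / 2) : ℝ) * z i) ^ 2 = (N : ℝ)⁻¹ * z i ^ 2 := by
    intro i
    rw [mul_pow, ← Real.rpow_natCast, ← Real.rpow_mul hN'.le]
    norm_num [Real.rpow_neg_one]
  have hsqb : ∀ t, 0 ≤ t → t < ϑ → |w t ^ 2 - (N : ℝ)⁻¹ * z ⌊(N : ℝ) * t⌋₊ ^ 2|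
      ≤ δ * (2 * M + 1) := by
    intro t h0 h1
    rw [← hsq]
    have h2 := hpre t h0 h1
    have h3 := hM t ⟨h0, h1.le⟩
    generalize (N : ℝ) ^ (-(1 / 2) : ℝ) * z ⌊(N : ℝ) * t⌋₊ = x at *
    have e : w t ^ 2 - x ^ 2 = (-(x - w t)) * ((x - w t) + 2 * w t) := by ring
    rw [e, abs_mul, abs_neg]
    have h4 : |(x - w t) + 2 * w t| ≤ 2 * M + 1 := by
      refine (abs_add_le _ _).trans ?_
      rw [abs_mul, abs_two]; linarith
    exact mul_le_mul h2 h4 (abs_nonneg _) hδ0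
  set r := min s ϑ with hr
  have hr0 : 0 ≤ r := le_min hs.1 hϑ.le
  have hrϑ : r ≤ ϑ := min_le_right _ _
  set k := ⌊(N : ℝ) * r⌋₊ with hk
  have hkle : (k : ℝ) ≤ N * r := Nat.floor_le (by positivity)
  have hkr : (k : ℝ) / N ≤ r := by rw [div_le_iff₀ hN']; linarith
  have hk1 : r - k / N ≤ (N : ℝ)⁻¹ := by
    have : (N : ℝ) * r < k + 1 := Nat.lt_floor_add_one _
    rw [sub_le_iff_le_add, ← one_div, ← add_div, le_div_iff₀ hN']; linarith
  have hk0 : (0 : ℝ) ≤ k / N := by positivity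
  have hw2 : ContinuousOn (fun t => w t ^ 2) (Set.Icc 0 ϑ) := hw.pow 2
  have hA := abs_integral_sub_sum_cells_le (f := fun t => w t ^ 2)
    (a := fun i => (N : ℝ)⁻¹ * z i ^ 2) hN hw2 hsqb k (hkr.trans hrϑ)
  have hint : ∀ x v : ℝ, 0 ≤ x → x ≤ v → v ≤ ϑ →
      IntervalIntegrable (fun t => w t ^ 2) volume x v := by
    intro x v hx hxv hv
    apply ContinuousOn.intervalIntegrable
    rw [Set.uIcc_of_le hxv]
    exact hw2.mono (Set.Icc_subset_Icc hx hv)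
  have hB : |∫ t in (k / N : ℝ)..r, w t ^ 2| ≤ M ^ 2 * (N : ℝ)⁻¹ := by
    have := intervalIntegral.norm_integral_le_of_norm_le_const (f := fun t => w t ^ 2)
      (a := (k / N : ℝ)) (b := r) (C := M ^ 2) ?_
    · rw [abs_of_nonneg (by linarith : 0 ≤ r - (k : ℝ) / N)] at this
      exact this.trans (by gcongr)
    · intro t ht
      rw [Set.uIoc_of_le hkr] at ht
      rw [norm_pow]
      exact pow_le_pow_left₀ (norm_nonneg _) (hM t ⟨hk0.trans ht.1.le, ht.2.trans hrϑ⟩) 2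
  have hsplit := intervalIntegral.integral_add_adjacent_intervals
    (hint 0 (k / N) le_rfl hk0 (hkr.trans hrϑ)) (hint (k / N) r hk0 hkr hrϑ)
  set n := ⌊(N : ℝ) * s⌋₊ with hn
  have hkn : k ≤ n := Nat.floor_le_floor (mul_le_mul_of_nonneg_left (min_le_left _ _) hN'.le)
  have hnN : n ≤ N := by
    apply Nat.floor_le_of_le
    nlinarith [hs.2]
  have hsum : ∑ i ∈ Icc 1 n, z i ^ 2 = ∑ i ∈ range k, z i ^ 2 + ∑ i ∈ Icc k n, z i ^ 2 := by
    have e1 : ∑ i ∈ range (n + 1), z i ^ 2 = ∑ i ∈ Icc 1 n, z i ^ 2 := by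
      rw [sum_range_eq_add_Ico _ (Nat.succ_pos n), hz0]
      simp [Finset.Ico_add_one_right_eq_Icc]
    rw [← e1, ← sum_range_add_sum_Ico _ (Nat.le_succ_of_le hkn),
      Nat.succ_eq_add_one, Finset.Ico_add_one_right_eq_Icc]
  have hPost : 0 ≤ ((N : ℝ) ^ 2)⁻¹ * ∑ i ∈ Icc ⌊(N : ℝ) * ϑ⌋₊ N, z i ^ 2 := by
    have : 0 ≤ ∑ i ∈ Icc ⌊(N : ℝ) * ϑ⌋₊ N, z i ^ 2 := sum_nonneg fun i _ => sq_nonneg _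
    positivity
  have hC : ((N : ℝ) ^ 2)⁻¹ * ∑ i ∈ Icc k n, z i ^ 2 ≤ (M + 1) ^ 2 * (N : ℝ)⁻¹
      + ((N : ℝ) ^ 2)⁻¹ * ∑ i ∈ Icc ⌊(N : ℝ) * ϑ⌋₊ N, z i ^ 2 := by
    rcases lt_or_ge s ϑ with hlt | hge
    · have hrs : r = s := min_eq_left hlt.le
      have hkn' : k = n := by rw [hk, hn, hrs]
      rw [hkn', Finset.Icc_self, sum_singleton]
      have h2 := hpre s hs.1 hlt
      have h3 := hM s ⟨hs.1, hlt.le⟩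
      have h4 : |(N : ℝ) ^ (-(1 / 2) : ℝ) * z n| ≤ M + 1 := by
        have := abs_add_le ((N : ℝ) ^ (-(1 / 2) : ℝ) * z n - w s) (w s)
        rw [sub_add_cancel] at this
        linarith
      have h5 : (N : ℝ)⁻¹ * z n ^ 2 ≤ (M + 1) ^ 2 := by
        rw [← hsq, ← sq_abs]
        exact pow_le_pow_left₀ (abs_nonneg _) h4 2
      have h6 : ((N : ℝ) ^ 2)⁻¹ * z n ^ 2 = ((N : ℝ)⁻¹ * z n ^ 2) * (N : ℝ)⁻¹ := by
        field_simp
      have h7 := mul_le_mul_of_nonneg_right h5 (inv_pos.2 hN').le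
      linarith
    · have hrs : r = ϑ := min_eq_right hge
      rw [hk, hrs]
      have h1 : ∑ i ∈ Icc ⌊(N : ℝ) * ϑ⌋₊ n, z i ^ 2 ≤ ∑ i ∈ Icc ⌊(N : ℝ) * ϑ⌋₊ N, z i ^ 2 :=
        sum_le_sum_of_subset_of_nonneg (Finset.Icc_subset_Icc le_rfl hnN)
          fun i _ _ => sq_nonneg _
      have h2 := mul_le_mul_of_nonneg_left h1 (inv_pos.2 (pow_pos hN' 2)).le
      have h3 : 0 ≤ (M + 1) ^ 2 * (N : ℝ)⁻¹ := by positivity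
      linarith
  have hC0 : 0 ≤ ((N : ℝ) ^ 2)⁻¹ * ∑ i ∈ Icc k n, z i ^ 2 := by
    have : 0 ≤ ∑ i ∈ Icc k n, z i ^ 2 := sum_nonneg fun i _ => sq_nonneg _
    positivity
  have hA' : δ * (2 * M + 1) * ((k : ℝ) / N) ≤ δ * (2 * M + 1) :=
    mul_le_of_le_one_right (by positivity) (by linarith)
  have hfac : (N : ℝ)⁻¹ * ∑ i ∈ range k, (N : ℝ)⁻¹ * z i ^ 2
      = ((N : ℝ) ^ 2)⁻¹ * ∑ i ∈ range k, z i ^ 2 := by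
    rw [← mul_sum, ← mul_assoc, sq, mul_inv]
  have hMM : M ^ 2 * (N : ℝ)⁻¹ ≤ (M + 1) ^ 2 * (N : ℝ)⁻¹ := by gcongr; linarith
  simp only [hfac] at hA
  rw [hsum, mul_add, ← hsplit]
  rw [abs_le] at hA hB ⊢
  constructor <;> linarith

/-- Replacing the normalisation `s⁻²` by the nearby `u⁻²` in a bounded quantity. -/
theorem abs_inv_sq_mul_sub_inv_sq_mul_le {κ u s S G C d : ℝ} (hκ : 0 < κ) (hu : κ / 2 ≤ u)
    (hs : κ ≤ s) (hs1 : s ≤ 1) (hus : u ≤ s) (hd : s - u ≤ d) (hG : |G| ≤ C) :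
    |(u ^ 2)⁻¹ * S - (s ^ 2)⁻¹ * G| ≤ 4 / κ ^ 2 * |S - G| + 8 / κ ^ 4 * C * d := by
  have hu0 : 0 < u := by linarith
  have hs0 : 0 < s := by linarith
  have h1 : (u ^ 2)⁻¹ ≤ 4 / κ ^ 2 := by
    rw [show 4 / κ ^ 2 = ((κ / 2) ^ 2)⁻¹ by field_simp; norm_num]
    gcongr
  have h2 : (s ^ 2)⁻¹ ≤ 1 / κ ^ 2 := by
    rw [one_div]
    gcongr
  have h3 : (u ^ 2)⁻¹ - (s ^ 2)⁻¹ = ((u ^ 2)⁻¹ * (s ^ 2)⁻¹) * ((s - u) * (s + u)) := by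
    field_simp
    ring
  have h4 : |(u ^ 2)⁻¹ - (s ^ 2)⁻¹| ≤ (4 / κ ^ 2 * (1 / κ ^ 2)) * (d * 2) := by
    have hsu : 0 ≤ s - u := by linarith
    rw [h3, abs_of_nonneg (by positivity)]
    have : s + u ≤ 2 := by linarith
    gcongr
    linarith
  have e : (u ^ 2)⁻¹ * S - (s ^ 2)⁻¹ * G
      = (u ^ 2)⁻¹ * (S - G) + ((u ^ 2)⁻¹ - (s ^ 2)⁻¹) * G := by ring
  rw [e]
  refine (abs_add_le _ _).trans ?_
  rw [abs_mul, abs_mul, abs_of_nonneg (by positivity : 0 ≤ (u ^ 2)⁻¹)]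
  have h5 : |(u ^ 2)⁻¹ - (s ^ 2)⁻¹| * |G| ≤ (4 / κ ^ 2 * (1 / κ ^ 2)) * (d * 2) * C :=
    mul_le_mul h4 hG (abs_nonneg _) ((abs_nonneg _).trans h4)
  have h6 : (4 / κ ^ 2 * (1 / κ ^ 2)) * (d * 2) * C = 8 / κ ^ 4 * C * d := by
    ring
  have h7 := mul_le_mul_of_nonneg_right h1 (abs_nonneg (S - G))
  linarith


/-- Deterministic form of the denominator convergence in Theorem 4.2
(I(1)-to-I(0) change-point model). Let `ϑ, κ ∈ (0,1)`, `w : [0,ϑ] → ℝ` continuous,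
and `(y_{N,i})` a triangular array with `y_{N,0} = 0` such that (i)
`sup_{s∈[0,ϑ)} |N^{−1/2} y_{N,⌊Ns⌋} − w(s)| → 0`, and (ii)
`N^{−2} ∑_{i=⌊Nϑ⌋}^{N} y_{N,i}² → 0`. Then
`sup_{s∈[κ,1]} |⌊Ns⌋^{−2} ∑_{i=1}^{⌊Ns⌋} y_{N,i}² − s^{−2} ∫_0^{min(s,ϑ)} w(t)² dt| → 0`. -/
theorem change_point_I1_to_I0_denominator (ϑ : ℝ) (hϑ : ϑ ∈ Set.Ioo (0 : ℝ) 1)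
    (κ : ℝ) (hκ : κ ∈ Set.Ioo (0 : ℝ) 1)
    (w : ℝ → ℝ) (hw : ContinuousOn w (Set.Icc (0 : ℝ) ϑ))
    (y : ℕ → ℕ → ℝ) (hy0 : ∀ N, y N 0 = 0)
    (hpre : ∀ ε > (0 : ℝ), ∃ N₀ : ℕ, ∀ N : ℕ, N₀ ≤ N → ∀ s : ℝ, 0 ≤ s → s < ϑ →
      |(N : ℝ) ^ (-(1 / 2) : ℝ) * y N ⌊(N : ℝ) * s⌋.toNat - w s| < ε)
    (hpost : Filter.Tendsto
      (fun N : ℕ => ((N : ℝ) ^ 2)⁻¹ * ∑ i ∈ Finset.Icc ⌊(N : ℝ) * ϑ⌋.toNat N, (y N i) ^ 2)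
      Filter.atTop (nhds 0)) :
    ∀ ε > (0 : ℝ), ∃ N₀ : ℕ, ∀ N : ℕ, N₀ ≤ N → ∀ s ∈ Set.Icc κ 1,
      |((⌊(N : ℝ) * s⌋.toNat : ℝ) ^ 2)⁻¹ *
          (∑ i ∈ Finset.Icc 1 ⌊(N : ℝ) * s⌋.toNat, (y N i) ^ 2) -
        (s ^ 2)⁻¹ * ∫ t in (0 : ℝ)..(min s ϑ), (w t) ^ 2| < ε := by
  intro ε hε
  obtain ⟨hϑ0, hϑ1⟩ := hϑ
  have hκ0 := hκ.1
  obtain ⟨M, hM⟩ := isCompact_Icc.exists_bound_of_continuousOn hw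
  simp only [Real.norm_eq_abs] at hM
  have hM0 : 0 ≤ M := (abs_nonneg _).trans (hM 0 ⟨le_rfl, hϑ0.le⟩)
  simp only [Int.floor_toNat] at *
  obtain ⟨δ, hδ0, hδ1, hδ⟩ : ∃ δ : ℝ, 0 < δ ∧ δ ≤ 1 ∧ 4 / κ ^ 2 * (δ * (2 * M + 1)) < ε := by
    have hpos : 0 < 4 / κ ^ 2 * (2 * M + 1) := by positivity
    refine ⟨min 1 (ε / 2 / (4 / κ ^ 2 * (2 * M + 1))), lt_min one_pos (by positivity),
      min_le_left _ _, ?_⟩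
    have := (le_div_iff₀ hpos).1 (min_le_right 1 (ε / 2 / (4 / κ ^ 2 * (2 * M + 1))))
    linarith
  have hinv : Tendsto (fun N : ℕ => (N : ℝ)⁻¹) atTop (nhds 0) :=
    tendsto_inv_atTop_nhds_zero_nat
  have hlim := (((hinv.const_mul (2 * (M + 1) ^ 2)).const_add (δ * (2 * M + 1))).add
    hpost).const_mul (4 / κ ^ 2) |>.add (hinv.const_mul (8 / κ ^ 4 * M ^ 2))
  simp only [mul_zero, add_zero] at hlim
  obtain ⟨N₁, hN₁⟩ := hpre δ hδ0
  have hev := ((hlim.eventually (gt_mem_nhds hδ)).and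
    (hinv.eventually (gt_mem_nhds (half_pos hκ0)))).and
    ((eventually_ge_atTop N₁).and (eventually_gt_atTop 0))
  obtain ⟨N₀, hN₀⟩ := eventually_atTop.1 hev
  refine ⟨N₀, fun N hN s hs => ?_⟩
  obtain ⟨⟨hbound, hNκ⟩, hNN₁, hNpos⟩ := hN₀ N hN
  have hN' : (0 : ℝ) < N := by exact_mod_cast hNpos
  have hs0 : 0 < s := hκ0.trans_le hs.1
  have hS := abs_sum_sq_sub_integral_le hϑ0 hϑ1 hδ1 hw hM (hy0 N) hNpos
    (fun t h0 h1 => (hN₁ N hNN₁ t h0 h1).le) ⟨hs0.le, hs.2⟩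
  have hnle : (⌊(N : ℝ) * s⌋₊ : ℝ) ≤ N * s := Nat.floor_le (by positivity)
  have hus : (⌊(N : ℝ) * s⌋₊ : ℝ) / N ≤ s := by rw [div_le_iff₀ hN']; linarith
  have hd : s - (⌊(N : ℝ) * s⌋₊ : ℝ) / N ≤ (N : ℝ)⁻¹ := by
    have : (N : ℝ) * s < ⌊(N : ℝ) * s⌋₊ + 1 := Nat.lt_floor_add_one _
    rw [sub_le_iff_le_add, ← one_div, ← add_div, le_div_iff₀ hN']; linarith
  have hG : |∫ t in (0 : ℝ)..(min s ϑ), w t ^ 2| ≤ M ^ 2 := by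
    have hr0 : 0 ≤ min s ϑ := le_min hs0.le hϑ0.le
    have := intervalIntegral.norm_integral_le_of_norm_le_const (f := fun t => w t ^ 2)
      (a := (0 : ℝ)) (b := min s ϑ) (C := M ^ 2) ?_
    · rw [sub_zero, abs_of_nonneg hr0] at this
      exact this.trans (mul_le_of_le_one_right (sq_nonneg M) ((min_le_left _ _).trans hs.2))
    · intro t ht
      rw [Set.uIoc_of_le hr0] at ht
      rw [norm_pow]
      exact pow_le_pow_left₀ (norm_nonneg _) (hM t ⟨ht.1.le, ht.2.trans (min_le_right _ _)⟩) 2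
  have hfin := abs_inv_sq_mul_sub_inv_sq_mul_le
    (S := ((N : ℝ) ^ 2)⁻¹ * ∑ i ∈ Icc 1 ⌊(N : ℝ) * s⌋₊, y N i ^ 2) hκ0
    (by linarith [hs.1]) hs.1 hs.2 hus hd hG
  have e : (((⌊(N : ℝ) * s⌋₊ : ℝ) / N) ^ 2)⁻¹
      * (((N : ℝ) ^ 2)⁻¹ * ∑ i ∈ Icc 1 ⌊(N : ℝ) * s⌋₊, y N i ^ 2)
      = ((⌊(N : ℝ) * s⌋₊ : ℝ) ^ 2)⁻¹ * ∑ i ∈ Icc 1 ⌊(N : ℝ) * s⌋₊, y N i ^ 2 := by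
    rw [← mul_assoc, ← mul_inv, ← mul_pow, div_mul_cancel₀ _ hN'.ne']
  rw [e] at hfin
  have hmul := mul_le_mul_of_nonneg_left hS (by positivity : 0 ≤ 4 / κ ^ 2)
  linarith
end
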